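/- Let f_1, f_2 ∈ B_6 and let f = f_1||f_2 ∈ B_7. If nl_2(f_1) = 17, then nl_2(f) ≤ 40. -/

import Mathlib

open scoped BigOperators

/-- Boolean functions in `n` variables. -/
abbrev BF (n : ℕ) := (Fin n → ZMod 2) → ZMod 2

/-- Hamming distance between two Boolean functions. -/
def hd {n : ℕ} (f g : BF n) : ℕ :=
  (Finset.univ.filter (fun x : Fin n → ZMod 2 => f x ≠ g x)).card

/-- The Reed--Muller code `RM(r,n)`: Boolean functions given by evaluation of a
multivariate polynomial over `F_2` of total degree at most `r`. -/
def RM (r n : ℕ) : Set (BF n) :=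
  {f | ∃ p : MvPolynomial (Fin n) (ZMod 2),
    p.totalDegree ≤ r ∧ ∀ x, f x = MvPolynomial.eval x p}

/-- The `r`-th order nonlinearity of a Boolean function. -/
noncomputable def nl (r : ℕ) {n : ℕ} (f : BF n) : ℕ :=
  sInf {d | ∃ g ∈ RM r n, d = hd f g}

/-- Concatenation `f1 || f2` of two Boolean functions. -/
def concat {n : ℕ} (f1 f2 : BF n) : BF (n + 1) :=
  fun x => (1 + x (Fin.last n)) * f1 (x ∘ Fin.castSucc)
    + x (Fin.last n) * f2 (x ∘ Fin.castSucc)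

/-- A Boolean function is homogeneous quadratic if it is of the form
`∑_{i<j} a_{ij} x_i x_j`. -/
def HomQuad {n : ℕ} (g : BF n) : Prop :=
  ∃ a : Fin n → Fin n → ZMod 2,
    ∀ x, g x = ∑ i : Fin n, ∑ j : Fin n, (if i < j then a i j * x i * x j else 0)

/-- `Fh f r` is the set of homogeneous quadratic functions `g` with `nl(f+g) = r`. -/
def Fh {n : ℕ} (f : BF n) (r : ℕ) : Set (BF n) :=
  {g | HomQuad g ∧ nl 1 (f + g) = r}

/-- `NFh f r = |Fh f r|`. -/
noncomputable def NFh {n : ℕ} (f : BF n) (r : ℕ) : ℕ := (Fh f r).ncard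

/-- The set of 6-variable Boolean functions with nonlinearity 16. -/
def S16 : Set (BF 6) := {f | nl 1 f = 16}

/-- `f1` and `f2` are affine equivalent modulo `RM(r,n)`. -/
def AffEquivMod (r n : ℕ) (f1 f2 : BF n) : Prop :=
  ∃ A : Matrix (Fin n) (Fin n) (ZMod 2), IsUnit A ∧ ∃ b : Fin n → ZMod 2,
    (fun x => f1 x + f2 (A.mulVec x + b)) ∈ RM r n

def fun1 : BF 6 := fun x => x 0*x 1*x 5 + x 0*x 2*x 4 + x 1*x 2*x 3

def fun2 : BF 6 := fun x => x 0*x 1*x 2*x 3 + x 0*x 1*x 5 + x 0*x 3*x 4 + x 1*x 2*x 4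

def fun3 : BF 6 := fun x => x 0*x 1*x 2*x 3 + x 0*x 2*x 4 + x 0*x 3*x 5 + x 1*x 2*x 4
  + x 1*x 2*x 5 + x 1*x 3*x 4

def fun4 : BF 6 := fun x => x 0*x 1*x 2*x 5 + x 0*x 1*x 3*x 4 + x 0*x 2*x 4
  + x 0*x 3*x 4 + x 0*x 3*x 5 + x 1*x 2*x 3

def fun5 : BF 6 := fun x => x 0*x 1*x 2*x 3*x 4 + x 0*x 2*x 4 + x 0*x 3*x 5
  + x 1*x 2*x 4 + x 1*x 2*x 5 + x 1*x 3*x 4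

def fun6 : BF 6 := fun x => x 0*x 1*x 2*x 3*x 4*x 5 + x 0*x 1*x 5 + x 0*x 2*x 4
  + x 1*x 2*x 3

def fun7 : BF 6 := fun x => x 0*x 1*x 2*x 3*x 4*x 5 + x 0*x 1*x 2*x 3 + x 0*x 1*x 5
  + x 0*x 3*x 4 + x 1*x 2*x 4 + x 3*x 4

def fun8 : BF 6 := fun x => x 0*x 1*x 2*x 3*x 4*x 5 + x 0*x 1*x 2*x 3 + x 0*x 2*x 4
  + x 0*x 3*x 5 + x 1*x 2*x 4 + x 1*x 2*x 5 + x 1*x 3*x 4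

def fun9 : BF 6 := fun x => x 0*x 1*x 2*x 3*x 4*x 5 + x 0*x 1*x 2*x 5 + x 0*x 1*x 3*x 4
  + x 0*x 2*x 4 + x 0*x 3*x 4 + x 0*x 3*x 5 + x 1*x 2*x 3 + x 3*x 5

def fun10 : BF 6 := fun x => x 0*x 1*x 2*x 3*x 4*x 5 + x 0*x 1*x 2*x 3 + x 0*x 2*x 3
  + x 0*x 4*x 5 + x 1*x 2*x 3 + x 1*x 2*x 5 + x 1*x 3*x 4 + x 2*x 3 + x 2*x 5 + x 3*x 4

def fun11 : BF 6 := fun x => x 0*x 1*x 2*x 3*x 4*x 5 + x 0*x 1*x 2*x 5 + x 0*x 1*x 3*x 4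
  + x 0*x 2*x 4 + x 0*x 3*x 4 + x 0*x 3*x 5 + x 1*x 2*x 3 + x 1*x 2*x 5 + x 1*x 3*x 4
  + x 2*x 4 + x 3*x 4 + x 3*x 5

def fun12 : BF 6 := fun x => x 0*x 1*x 2*x 3*x 4*x 5 + x 1*x 2*x 3*x 4 + x 0*x 1*x 4*x 5
  + x 0*x 2*x 3*x 5 + x 0*x 1*x 3 + x 0*x 1*x 4 + x 1*x 2*x 4 + x 2*x 3*x 4
  + x 0*x 1*x 5 + x 2*x 3*x 5

def g0 : BF 6 := fun x => x 0*x 1*x 2 + x 0*x 3*x 4 + x 1*x 3*x 5 + x 2*x 4*x 5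
  + x 3*x 4*x 5

theorem RM_mono {r s n : ℕ} (h : r ≤ s) {f : BF n} (hf : f ∈ RM r n) : f ∈ RM s n := by
  obtain ⟨p, hp, hpf⟩ := hf
  exact ⟨p, hp.trans h, hpf⟩

theorem RM_add {r n : ℕ} {f g : BF n} (hf : f ∈ RM r n) (hg : g ∈ RM r n) : f + g ∈ RM r n := by
  obtain ⟨p, hp, hpf⟩ := hf
  obtain ⟨q, hq, hqg⟩ := hg
  exact ⟨p + q, (MvPolynomial.totalDegree_add p q).trans (max_le hp hq),
    fun x => by simp [hpf, hqg]⟩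

theorem RM_const {r n : ℕ} (c : ZMod 2) : (fun _ => c : BF n) ∈ RM r n :=
  ⟨MvPolynomial.C c, by simp, fun x => by simp⟩

theorem RM_zero {r n : ℕ} : (0 : BF n) ∈ RM r n := RM_const 0

theorem RM_coord {n : ℕ} (i : Fin n) : (fun x => x i : BF n) ∈ RM 1 n :=
  ⟨MvPolynomial.X i, by simp, fun x => by simp⟩

theorem RM_mul {r s n : ℕ} {f g : BF n} (hf : f ∈ RM r n) (hg : g ∈ RM s n) :
    f * g ∈ RM (r + s) n := by
  obtain ⟨p, hp, hpf⟩ := hf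
  obtain ⟨q, hq, hqg⟩ := hg
  exact ⟨p * q, (MvPolynomial.totalDegree_mul p q).trans (add_le_add hp hq),
    fun x => by simp [hpf, hqg]⟩

theorem RM_sum {r n : ℕ} {ι : Type*} (s : Finset ι) (f : ι → BF n)
    (h : ∀ i ∈ s, f i ∈ RM r n) : ∑ i ∈ s, f i ∈ RM r n := by
  classical
  induction s using Finset.induction_on with
  | empty => simpa using RM_zero
  | insert a s ha ih =>
    rw [Finset.sum_insert ha]
    exact RM_add (h a (by simp)) (ih fun i hi => h i (by simp [hi]))

theorem RM_pow {r n : ℕ} {f : BF n} (hf : f ∈ RM r n) (k : ℕ) : f ^ k ∈ RM (k * r) n := by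
  induction k with
  | zero => exact RM_mono (Nat.zero_le _) (RM_const (r := 0) (n := n) 1)
  | succ k ih =>
    rw [pow_succ, Nat.succ_mul]
    exact RM_mul ih hf

theorem RM_prod {n : ℕ} {ι : Type*} (s : Finset ι) (f : ι → BF n) (r : ι → ℕ)
    (h : ∀ i ∈ s, f i ∈ RM (r i) n) : ∏ i ∈ s, f i ∈ RM (∑ i ∈ s, r i) n := by
  classical
  induction s using Finset.induction_on with
  | empty => exact RM_mono (Nat.zero_le _) (RM_const (r := 0) (n := n) 1)
  | insert a s ha ih =>
    rw [Finset.prod_insert ha, Finset.sum_insert ha]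
    exact RM_mul (h a (by simp)) (ih fun i hi => h i (by simp [hi]))

theorem RM_comp {r m n : ℕ} {g : BF n} (hg : g ∈ RM r n) {φ : (Fin m → ZMod 2) → Fin n → ZMod 2}
    (hφ : ∀ i, (fun x => φ x i) ∈ RM 1 m) : (fun x => g (φ x)) ∈ RM r m := by
  obtain ⟨p, hp, hpg⟩ := hg
  have key : (fun x => g (φ x)) =
      ∑ d ∈ p.support, (fun _ => p.coeff d) * ∏ i, (fun x => φ x i) ^ (d i) := by
    funext x
    rw [hpg, MvPolynomial.eval_eq']
    simp [Finset.sum_apply, Finset.prod_apply]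
  rw [key]
  refine RM_sum _ _ fun d hd => ?_
  have h1 : ∏ i, (fun x => φ x i) ^ (d i) ∈ RM (∑ i, d i * 1) m :=
    RM_prod _ _ _ fun i _ => RM_pow (hφ i) _
  have h2 : ∑ i, d i * 1 ≤ r := by
    have := MvPolynomial.le_totalDegree hd
    rw [Finsupp.sum_fintype _ _ (by simp)] at this
    simpa using this.trans hp
  have h3 := RM_mul (RM_const (r := 0) (p.coeff d)) (RM_mono h2 h1)
  simpa using h3

theorem BF_add_self {n : ℕ} (f : BF n) : f + f = 0 := by
  funext x
  exact CharTwo.add_self_eq_zero _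

theorem BF_add_cancel {n : ℕ} (f g : BF n) : f + g + g = f := by
  rw [add_assoc, BF_add_self, add_zero]

theorem hd_add_right {n : ℕ} (f g q : BF n) : hd (f + q) (g + q) = hd f g := by
  simp [hd]

theorem hd_add_swap {n : ℕ} (f g q : BF n) : hd (f + q) g = hd f (g + q) := by
  rw [← hd_add_right f (g + q) q, BF_add_cancel]

theorem hd_comp {n : ℕ} (f g : BF n) (σ : (Fin n → ZMod 2) ≃ (Fin n → ZMod 2)) :
    hd (f ∘ σ) (g ∘ σ) = hd f g := by
  unfold hd
  refine Finset.card_bij (fun x _ => σ x) ?_ ?_ ?_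
  · intro x hx
    simpa using hx
  · intro x _ y _ h
    exact σ.injective h
  · intro y hy
    exact ⟨σ.symm y, by simpa using hy, by simp⟩

theorem hd_triangle {n : ℕ} (f g h : BF n) : hd f h ≤ hd f g + hd g h := by
  classical
  unfold hd
  refine le_trans (Finset.card_le_card ?_) (Finset.card_union_le _ _)
  intro x
  simp only [Finset.mem_filter, Finset.mem_univ, true_and, Finset.mem_union]
  intro hx
  by_contra! hc
  exact hx (hc.1.trans hc.2)

/-- Affine permutations of `F_2^n`. -/
def IsAff {n : ℕ} (σ : (Fin n → ZMod 2) ≃ (Fin n → ZMod 2)) : Prop :=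
  (∀ i, (fun x => σ x i) ∈ RM 1 n) ∧ ∀ i, (fun x => σ.symm x i) ∈ RM 1 n

theorem IsAff.symm {n : ℕ} {σ : (Fin n → ZMod 2) ≃ (Fin n → ZMod 2)} (h : IsAff σ) :
    IsAff σ.symm := ⟨h.2, h.1⟩

theorem IsAff.trans {n : ℕ} {σ τ : (Fin n → ZMod 2) ≃ (Fin n → ZMod 2)} (h : IsAff σ)
    (h' : IsAff τ) : IsAff (σ.trans τ) :=
  ⟨fun i => RM_comp (h'.1 i) h.1, fun i => RM_comp (h.2 i) h'.2⟩

theorem RM_comp_aff {r n : ℕ} {g : BF n} (hg : g ∈ RM r n)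
    {σ : (Fin n → ZMod 2) ≃ (Fin n → ZMod 2)} (h : IsAff σ) : g ∘ σ ∈ RM r n :=
  RM_comp hg h.1

/-- Predicates invariant under addition of elements of `RM(r,n)` and affine permutations. -/
structure AffInv (r : ℕ) {n : ℕ} (P : BF n → Prop) : Prop where
  add : ∀ f q, q ∈ RM r n → P f → P (f + q)
  comp : ∀ f (σ : (Fin n → ZMod 2) ≃ (Fin n → ZMod 2)), IsAff σ → P f → P (f ∘ σ)

/-- `f` is within distance `k` of a quadratic function. -/
def Near {n : ℕ} (k : ℕ) (f : BF n) : Prop := ∃ Q ∈ RM 2 n, hd f Q ≤ k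

/-- Every function in the coset `f + RM(2,n)` has nonlinearity at most `k`. -/
def Covered {n : ℕ} (k : ℕ) (f : BF n) : Prop :=
  ∀ q ∈ RM 2 n, ∃ a ∈ RM 1 n, hd (f + q) a ≤ k

theorem inv_near {n : ℕ} (k : ℕ) : AffInv 2 (Near k : BF n → Prop) where
  add := fun f q hq ⟨Q, hQ, h⟩ => ⟨Q + q, RM_add hQ hq, by rwa [hd_add_right]⟩
  comp := fun f σ hσ ⟨Q, hQ, h⟩ => ⟨Q ∘ σ, RM_comp_aff hQ hσ, by rwa [hd_comp]⟩

theorem inv_near_affine {n : ℕ} (k : ℕ) :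
    AffInv 1 (fun f : BF n => ∃ a ∈ RM 1 n, hd f a ≤ k) where
  add := fun f q hq ⟨Q, hQ, h⟩ => ⟨Q + q, RM_add hQ hq, by rwa [hd_add_right]⟩
  comp := fun f σ hσ ⟨Q, hQ, h⟩ => ⟨Q ∘ σ, RM_comp_aff hQ hσ, by rwa [hd_comp]⟩

theorem inv_covered {n : ℕ} (k : ℕ) : AffInv 2 (Covered k : BF n → Prop) where
  add := fun f q hq h p hp => by
    rw [add_assoc]
    exact h _ (RM_add hq hp)
  comp := fun f σ hσ h q hq => by
    obtain ⟨a, ha, h'⟩ := h _ (RM_comp_aff hq hσ.symm)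
    refine ⟨a ∘ σ, RM_comp_aff ha hσ, ?_⟩
    have : f ∘ σ + q = (f + q ∘ σ.symm) ∘ σ := by
      funext x
      simp
    rwa [this, hd_comp]

theorem AffInv.and {r n : ℕ} {P Q : BF n → Prop} (hP : AffInv r P) (hQ : AffInv r Q) :
    AffInv r (fun f => P f ∧ Q f) where
  add := fun f q hq h => ⟨hP.add f q hq h.1, hQ.add f q hq h.2⟩
  comp := fun f σ hσ h => ⟨hP.comp f σ hσ h.1, hQ.comp f σ hσ h.2⟩

theorem AffInv.or {r n : ℕ} {P Q : BF n → Prop} (hP : AffInv r P) (hQ : AffInv r Q) :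
    AffInv r (fun f => P f ∨ Q f) where
  add := fun f q hq h => h.imp (hP.add f q hq) (hQ.add f q hq)
  comp := fun f σ hσ h => h.imp (hP.comp f σ hσ) (hQ.comp f σ hσ)

theorem AffInv.of_comp {r n : ℕ} {P : BF n → Prop} (hP : AffInv r P) {f : BF n}
    {σ : (Fin n → ZMod 2) ≃ (Fin n → ZMod 2)} (hσ : IsAff σ) (h : P (f ∘ σ)) : P f := by
  have := hP.comp _ _ hσ.symm h
  have e : (f ∘ σ) ∘ σ.symm = f := by
    funext x
    simp
  rwa [e] at this

theorem AffInv.of_add {r n : ℕ} {P : BF n → Prop} (hP : AffInv r P) {f q : BF n}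
    (hq : q ∈ RM r n) (h : P (f + q)) : P f := by
  have := hP.add _ _ hq h
  rwa [BF_add_cancel] at this

/-- Indicator function of the point `p`. -/
def pt {n : ℕ} (p : Fin n → ZMod 2) : BF n := fun x => if x = p then 1 else 0

theorem pt_comp {n : ℕ} (p : Fin n → ZMod 2) (σ : (Fin n → ZMod 2) ≃ (Fin n → ZMod 2)) :
    pt p ∘ σ = pt (σ.symm p) := by
  funext x
  simp [pt, Equiv.eq_symm_apply]

theorem hd_add_pt {n : ℕ} (f g : BF n) (p : Fin n → ZMod 2) : hd (f + pt p) g ≤ hd f g + 1 := by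
  have h1 : hd (f + pt p) f ≤ 1 := by
    unfold hd
    refine (Finset.card_le_card (t := {p}) ?_).trans (by simp)
    intro x
    rw [Finset.mem_filter, Finset.mem_singleton]
    rintro ⟨-, h⟩
    by_contra hc
    simp [pt, hc] at h
  have := hd_triangle (f + pt p) f g
  omega

/-- The dichotomy for six-variable functions. -/
def Dich (f : BF 6) : Prop := Near 16 f ∨ Covered 23 f

theorem inv_dich : AffInv 2 Dich := (inv_near 16).or (inv_covered 23)

/-- The dichotomy for a function and all its one-point modifications. -/
def DichPt (f : BF 6) : Prop := Dich f ∧ ∀ p, Dich (f + pt p)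

theorem inv_dichPt : AffInv 2 DichPt where
  add := fun f q hq h => ⟨inv_dich.add f q hq h.1, fun p => by
    rw [add_right_comm]
    exact inv_dich.add _ q hq (h.2 p)⟩
  comp := fun f σ hσ h => ⟨inv_dich.comp f σ hσ h.1, fun p => by
    have := inv_dich.comp _ σ hσ (h.2 (σ p))
    have e : (f + pt (σ p)) ∘ σ = f ∘ σ + pt p := by
      rw [show (f + pt (σ p)) ∘ σ = f ∘ σ + pt (σ p) ∘ σ from rfl, pt_comp]
      simp
    rwa [e] at this⟩

/-- The element of `F_2` given by a Boolean. -/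
def bit (b : Bool) : ZMod 2 := if b then 1 else 0

theorem bit_xor (a b : Bool) : bit (a ^^ b) = bit a + bit b := by
  revert a b
  decide

theorem bit_inj {a b : Bool} (h : bit a = bit b) : a = b := by
  revert a b
  decide

theorem bit_decide (c : ZMod 2) : bit (decide (c = 1)) = c := by
  revert c
  decide

/-- The integer whose binary digits are the coordinates of `x`. -/
def idx {n : ℕ} (x : Fin n → ZMod 2) : ℕ := Nat.ofBits fun i => decide (x i = 1)

theorem idx_lt {n : ℕ} (x : Fin n → ZMod 2) : idx x < 2 ^ n := Nat.ofBits_lt_two_pow _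

theorem bit_testBit_idx {n : ℕ} (x : Fin n → ZMod 2) (i : Fin n) :
    bit ((idx x).testBit i) = x i := by
  rw [idx, Nat.testBit_ofBits_lt _ _ i.2, bit_decide]

theorem idx_injective {n : ℕ} : Function.Injective (idx : (Fin n → ZMod 2) → ℕ) := by
  intro x y h
  funext i
  rw [← bit_testBit_idx x i, h, bit_testBit_idx]

/-- The vector of the first `n` binary digits of `k`. -/
def vec (n k : ℕ) : Fin n → ZMod 2 := fun i => bit (k.testBit i)

theorem vec_idx {n : ℕ} (x : Fin n → ZMod 2) : vec n (idx x) = x :=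
  funext fun i => bit_testBit_idx x i

theorem idx_vec {n k : ℕ} (h : k < 2 ^ n) : idx (vec n k) = k := by
  have : ∀ b, decide (bit b = 1) = b := by decide
  have h' : (fun i : Fin n => decide (vec n k i = 1)) = fun i : Fin n => k.testBit i :=
    funext fun i => this (k.testBit i)
  rw [idx, h', Nat.ofBits_testBit, Nat.mod_eq_of_lt h]

/-- The function with truth table `T`. -/
def tt (n T : ℕ) : BF n := fun x => bit (T.testBit (idx x))

theorem tt_xor (n S T : ℕ) : tt n (S ^^^ T) = tt n S + tt n T := by
  funext x
  simp [tt, Nat.testBit_xor, bit_xor]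

theorem exists_tt {n : ℕ} (f : BF n) : ∃ T < 2 ^ 2 ^ n, tt n T = f := by
  refine ⟨Nat.ofBits fun k : Fin (2 ^ n) => decide (f (vec n k) = 1), Nat.ofBits_lt_two_pow _, ?_⟩
  funext x
  rw [tt, Nat.testBit_ofBits_lt _ _ (idx_lt x), bit_decide, vec_idx]

/-- The function whose algebraic normal form has the monomials listed by the digits of `A`. -/
def an (n A : ℕ) : BF n := fun x =>
  ∑ m ∈ Finset.range 64, bit (A.testBit m) * bit (m &&& idx x == m)

theorem an_xor (n A B : ℕ) : an n (A ^^^ B) = an n A + an n B := by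
  funext x
  simp [an, Nat.testBit_xor, bit_xor, add_mul, Finset.sum_add_distrib]

theorem an_zero (n : ℕ) : an n 0 = 0 := by
  funext x
  simp [an, bit]

theorem an_two_pow {n m : ℕ} (hm : m < 64) (x : Fin n → ZMod 2) :
    an n (2 ^ m) x = bit (m &&& idx x == m) := by
  rw [an, Finset.sum_eq_single m]
  · simp [bit]
  · intro k _ hk
    rw [Nat.testBit_two_pow_of_ne hk.symm]
    simp [bit]
  · intro h
    simp at h
    omega

theorem xor_induction {p : ℕ → Prop} (N : ℕ) (h0 : p 0) (hadd : ∀ a b, p a → p b → p (a ^^^ b))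
    (hpow : ∀ m < N, p (2 ^ m)) : ∀ A < 2 ^ N, p A := by
  induction N with
  | zero =>
    intro A hA
    obtain rfl : A = 0 := by omega
    exact h0
  | succ N ih =>
    intro A hA
    have ih := ih fun m hm => hpow m (by omega)
    rcases lt_or_ge A (2 ^ N) with h | h
    · exact ih A h
    · have hs : (A ^^^ 2 ^ N) < 2 ^ N := by
        refine Nat.lt_pow_two_of_testBit _ fun i hi => ?_
        rw [Nat.testBit_xor]
        rcases hi.eq_or_lt with rfl | hi
        · rw [Nat.testBit_two_pow_self]
          have : A.testBit N = true := by
            by_contra hc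
            have : A < 2 ^ N := Nat.lt_pow_two_of_testBit _ fun i hi => by
              rcases hi.eq_or_lt with rfl | hi
              · simpa using hc
              · exact Nat.testBit_lt_two_pow (hA.trans_le (Nat.pow_le_pow_right (by norm_num) hi))
            omega
          simp [this]
        · rw [Nat.testBit_two_pow_of_ne (by omega), Nat.testBit_lt_two_pow
            (hA.trans_le (Nat.pow_le_pow_right (by norm_num) hi))]
          rfl
      have := hadd _ _ (ih _ hs) (hpow N (by omega))
      rwa [Nat.xor_assoc, Nat.xor_self, Nat.xor_zero] at this

/-- Maps on integers additive for the exclusive or. -/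
def XorHom (F : ℕ → ℕ) : Prop := ∀ a b, F (a ^^^ b) = F a ^^^ F b

theorem XorHom.map_zero {F : ℕ → ℕ} (h : XorHom F) : F 0 = 0 := by
  have := h 0 0
  simpa using this

theorem XorHom.comp {F G : ℕ → ℕ} (hF : XorHom F) (hG : XorHom G) : XorHom fun A => F (G A) :=
  fun a b => by
    change F (G (a ^^^ b)) = F (G a) ^^^ F (G b)
    rw [hG, hF]

theorem XorHom.xor {F G : ℕ → ℕ} (hF : XorHom F) (hG : XorHom G) :
    XorHom fun A => (F A).xor (G A) := fun a b => by
  change (F (a ^^^ b)) ^^^ (G (a ^^^ b)) = (F a ^^^ G a) ^^^ (F b ^^^ G b)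
  rw [hF, hG]
  ac_rfl

theorem xorHom_id : XorHom fun A => A := fun _ _ => rfl

theorem xorHom_land (M : ℕ) : XorHom fun A => A.land M := fun a b =>
  Nat.eq_of_testBit_eq fun i => by
    change ((a ^^^ b) &&& M).testBit i = ((a &&& M) ^^^ (b &&& M)).testBit i
    simp only [Nat.testBit_and, Nat.testBit_xor]
    cases M.testBit i <;> simp

theorem xorHom_shiftLeft (s : ℕ) : XorHom fun A => A.shiftLeft s := fun a b =>
  Nat.eq_of_testBit_eq fun i => by
    change ((a ^^^ b) <<< s).testBit i = ((a <<< s) ^^^ (b <<< s)).testBit i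
    simp only [Nat.testBit_shiftLeft, Nat.testBit_xor]
    cases decide (s ≤ i) <;> simp

theorem xorHom_shiftRight (s : ℕ) : XorHom fun A => A.shiftRight s := fun a b =>
  Nat.eq_of_testBit_eq fun i => by
    change ((a ^^^ b) >>> s).testBit i = ((a >>> s) ^^^ (b >>> s)).testBit i
    simp only [Nat.testBit_shiftRight, Nat.testBit_xor]

theorem XorHom.eq_of_basis {F G : ℕ → ℕ} (hF : XorHom F) (hG : XorHom G) (N : ℕ)
    (h : ∀ m < N, F (2 ^ m) = G (2 ^ m)) : ∀ A < 2 ^ N, F A = G A :=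
  xor_induction N (by rw [hF.map_zero, hG.map_zero]) (fun a b ha hb => by rw [hF, hG, ha, hb]) h

/-- One step of the binary Möbius transform. -/
def mobStep (N s A : ℕ) : ℕ := Nat.xor A (Nat.shiftLeft (Nat.land A N) s)

theorem xorHom_mobStep (N s : ℕ) : XorHom (mobStep N s) :=
  xorHom_id.xor ((xorHom_shiftLeft s).comp (xorHom_land N))

/-- The binary Möbius transform in six variables. -/
def mob (A : ℕ) : ℕ :=
  mobStep 4294967295 32
  (mobStep 281470681808895 16
  (mobStep 71777214294589695 8
  (mobStep 1085102592571150095 4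
  (mobStep 3689348814741910323 2
  (mobStep 6148914691236517205 1 A)))))

theorem xorHom_mob : XorHom mob :=
  (xorHom_mobStep _ _).comp ((xorHom_mobStep _ _).comp ((xorHom_mobStep _ _).comp
    ((xorHom_mobStep _ _).comp ((xorHom_mobStep _ _).comp (xorHom_mobStep _ _)))))

theorem mob_two_pow_testBit : ∀ m < 64, ∀ k < 64, (mob (2 ^ m)).testBit k = (m &&& k == m) := by
  decide +kernel

theorem mob_two_pow_lt : ∀ m < 64, mob (2 ^ m) < 2 ^ 64 := by
  decide +kernel

theorem mob_mob_two_pow : ∀ m < 64, mob (mob (2 ^ m)) = 2 ^ m := by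
  decide +kernel

theorem mob_mob : ∀ A < 2 ^ 64, mob (mob A) = A :=
  (xorHom_mob.comp xorHom_mob).eq_of_basis xorHom_id 64 mob_mob_two_pow

theorem XorHom.lt_of_basis {F : ℕ → ℕ} (hF : XorHom F) (h : ∀ m < 64, F (2 ^ m) < 2 ^ 64) :
    ∀ A < 2 ^ 64, F A < 2 ^ 64 :=
  xor_induction 64 (by rw [hF.map_zero]; norm_num)
    (fun a b ha hb => by rw [hF]; exact Nat.xor_lt_two_pow ha hb) h

theorem mob_lt : ∀ A < 2 ^ 64, mob A < 2 ^ 64 := xorHom_mob.lt_of_basis mob_two_pow_lt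

theorem idx_lt64 {n : ℕ} (hn : n ≤ 6) (x : Fin n → ZMod 2) : idx x < 64 :=
  (idx_lt x).trans_le (Nat.pow_le_pow_right (n := 2) (by norm_num) hn)

theorem an_eq_tt {n : ℕ} (hn : n ≤ 6) : ∀ A < 2 ^ 64, an n A = tt n (mob A) := by
  refine xor_induction 64 ?_ ?_ ?_
  · rw [xorHom_mob.map_zero, an_zero]
    funext x
    simp [tt, bit]
  · intro a b ha hb
    rw [an_xor, xorHom_mob, tt_xor, ha, hb]
  · intro m hm
    funext x
    rw [an_two_pow hm, tt, mob_two_pow_testBit m hm _ (idx_lt64 hn x)]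

theorem exists_an {n : ℕ} (hn : n ≤ 6) (f : BF n) : ∃ A < 2 ^ 64, an n A = f := by
  obtain ⟨T, hT, rfl⟩ := exists_tt f
  have hT : T < 2 ^ 64 := hT.trans_le
    (Nat.pow_le_pow_right (by norm_num) (Nat.pow_le_pow_right (n := 2) (by norm_num) hn))
  exact ⟨mob T, mob_lt T hT, by rw [an_eq_tt hn _ (mob_lt T hT), mob_mob T hT]⟩

theorem an_injective {A B : ℕ} (hA : A < 2 ^ 64) (hB : B < 2 ^ 64) (h : an 6 A = an 6 B) :
    A = B := by
  rw [an_eq_tt le_rfl A hA, an_eq_tt le_rfl B hB] at h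
  rw [← mob_mob A hA, ← mob_mob B hB]
  congr 1
  refine Nat.eq_of_testBit_eq fun k => ?_
  rcases lt_or_ge k 64 with hk | hk
  · have := congrFun h (vec 6 k)
    rw [tt, tt, idx_vec (n := 6) hk] at this
    exact bit_inj this
  · have hp : 2 ^ 64 ≤ 2 ^ k := Nat.pow_le_pow_right (by norm_num) hk
    rw [Nat.testBit_lt_two_pow ((mob_lt A hA).trans_le hp),
      Nat.testBit_lt_two_pow ((mob_lt B hB).trans_le hp)]

/-- The number of ones among the first six binary digits. -/
def bw (m : ℕ) : ℕ := ((Finset.range 6).filter fun i => m.testBit i = true).card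

theorem bw_eq {n m : ℕ} (hn : n ≤ 6) (hm : m < 2 ^ n) :
    bw m = (Finset.univ.filter fun i : Fin n => m.testBit i = true).card := by
  rw [← Finset.card_map Fin.valEmbedding, bw]
  congr 1
  ext i
  simp only [Finset.mem_filter, Finset.mem_range, Finset.mem_map, Finset.mem_univ, true_and,
    Fin.valEmbedding_apply]
  constructor
  · rintro ⟨_, h⟩
    have : i < n := by
      by_contra hc
      rw [Nat.testBit_lt_two_pow (hm.trans_le (Nat.pow_le_pow_right (by norm_num) (by omega)))] at h
      exact Bool.false_ne_true h
    exact ⟨⟨i, this⟩, h, rfl⟩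
  · rintro ⟨j, h, rfl⟩
    exact ⟨by omega, h⟩

theorem monomial_eq {n m : ℕ} (hm : m < 2 ^ n) (x : Fin n → ZMod 2) :
    bit (m &&& idx x == m) = ∏ i : Fin n, if m.testBit i = true then x i else 1 := by
  have key : (m &&& idx x == m) = true ↔ ∀ i : Fin n, m.testBit i = true → x i = 1 := by
    rw [beq_iff_eq]
    constructor
    · intro h i hi
      rw [← h, Nat.testBit_and, Bool.and_eq_true] at hi
      rw [← bit_testBit_idx x i, hi.2]
      rfl
    · intro h
      refine Nat.eq_of_testBit_eq fun i => ?_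
      rw [Nat.testBit_and]
      rcases hb : m.testBit i with _ | _
      · rfl
      · have hi : i < n := by
          by_contra hc
          rw [Nat.testBit_lt_two_pow
            (hm.trans_le (Nat.pow_le_pow_right (by norm_num) (by omega)))] at hb
          exact Bool.false_ne_true hb
        have := h ⟨i, hi⟩ hb
        rw [← bit_testBit_idx x ⟨i, hi⟩] at this
        rw [show (idx x).testBit i = true from bit_inj (this.trans rfl)]
        rfl
  rcases hb : (m &&& idx x == m) with _ | _
  · rw [hb] at key
    simp only [Bool.false_eq_true, false_iff, not_forall] at key
    obtain ⟨i, hi, hx⟩ := key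
    refine (Finset.prod_eq_zero (Finset.mem_univ i) ?_).symm
    rw [if_pos hi]
    revert hx
    generalize x i = c
    revert c
    decide
  · refine (Finset.prod_eq_one fun i _ => ?_).symm
    split
    · exact key.1 hb i ‹_›
    · rfl

theorem monomial_mem {n m : ℕ} (hn : n ≤ 6) (hm : m < 2 ^ n) :
    (fun x => bit (m &&& idx x == m) : BF n) ∈ RM (bw m) n := by
  have h : (fun x => bit (m &&& idx x == m) : BF n) =
      ∏ i ∈ Finset.univ.filter (fun i : Fin n => m.testBit i = true), fun x => x i := by
    funext x
    rw [monomial_eq hm, Finset.prod_apply, Finset.prod_filter]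
  rw [h, bw_eq hn hm, Finset.card_eq_sum_ones]
  exact RM_prod _ _ _ fun i _ => RM_coord i

theorem an_mem_RM {n r A : ℕ} (hn : n ≤ 6)
    (h : ∀ m < 64, A.testBit m = true → m < 2 ^ n → bw m ≤ r) : an n A ∈ RM r n := by
  have e : an n A = ∑ m ∈ Finset.range 64,
      fun x => bit (A.testBit m) * bit (m &&& idx x == m) := by
    funext x
    rw [an, Finset.sum_apply]
  rw [e]
  refine RM_sum _ _ fun m hm => ?_
  rcases hb : A.testBit m with _ | _
  · simpa [bit] using RM_const (r := r) (n := n) 0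
  · rcases lt_or_ge m (2 ^ n) with hlt | hge
    · have := RM_mono (h m (by simpa using hm) hb hlt) (monomial_mem hn hlt)
      simpa [bit] using this
    · have : ∀ x : Fin n → ZMod 2, (m &&& idx x == m) = false := fun x => by
        have h1 := Nat.and_le_right (n := m) (m := idx x)
        have h2 := idx_lt x
        rw [beq_eq_false_iff_ne]
        omega
      simp only [this]
      simpa [bit] using RM_const (r := r) (n := n) 0

theorem exists_an_of_RM {n r : ℕ} (hn : n ≤ 6) {f : BF n} (hf : f ∈ RM r n) :
    ∃ A < 2 ^ 64, (∀ m, A.testBit m = true → m < 2 ^ n ∧ bw m ≤ r) ∧ an n A = f := by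
  obtain ⟨p, hp, hpf⟩ := hf
  have key : f = ∑ d ∈ p.support, fun x => p.coeff d * ∏ i, x i ^ d i := by
    funext x
    rw [hpf, MvPolynomial.eval_eq', Finset.sum_apply]
  have step : ∀ s ⊆ p.support, ∃ A < 2 ^ 64,
      (∀ m, A.testBit m = true → m < 2 ^ n ∧ bw m ≤ r) ∧
      an n A = ∑ d ∈ s, fun x => p.coeff d * ∏ i, x i ^ d i := by
    classical
    intro s
    induction s using Finset.induction_on with
    | empty =>
      intro _
      exact ⟨0, by norm_num, by simp, by simp [an_zero]⟩
    | insert d s hd ih =>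
      intro hs
      obtain ⟨A, hA, hbits, hAf⟩ := ih fun x hx => hs (Finset.mem_insert_of_mem hx)
      have hdp : d ∈ p.support := hs (Finset.mem_insert_self _ _)
      have hdeg : ∑ i, d i ≤ r := by
        have := MvPolynomial.le_totalDegree hdp
        rw [Finsupp.sum_fintype _ _ (by simp)] at this
        exact this.trans hp
      have hc : p.coeff d = 1 := by
        have := MvPolynomial.mem_support_iff.1 hdp
        revert this
        generalize p.coeff d = c
        revert c
        decide
      set m := idx (fun i : Fin n => if d i = 0 then (0 : ZMod 2) else 1) with hm
      have hmlt : m < 2 ^ n := idx_lt _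
      have hm64 : m < 64 := idx_lt64 hn _
      have htb : ∀ i : Fin n, m.testBit i = true ↔ d i ≠ 0 := fun i => by
        have := bit_testBit_idx (fun i : Fin n => if d i = 0 then (0 : ZMod 2) else 1) i
        rw [← hm] at this
        by_cases h0 : d i = 0
        · rw [if_pos h0] at this
          rw [show m.testBit i = false from bit_inj (this.trans rfl)]
          simp [h0]
        · rw [if_neg h0] at this
          rw [show m.testBit i = true from bit_inj (this.trans rfl)]
          simp [h0]
      clear_value m
      have hmp : 2 ^ m < 2 ^ 64 := Nat.pow_lt_pow_right (by norm_num) hm64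
      refine ⟨2 ^ m ^^^ A, Nat.xor_lt_two_pow hmp hA, ?_, ?_⟩
      · intro k hk
        rw [Nat.testBit_xor] at hk
        by_cases hne : m = k
        · rw [← hne]
          refine ⟨hmlt, ?_⟩
          rw [bw_eq hn hmlt, Finset.card_eq_sum_ones, Finset.sum_filter]
          refine (Finset.sum_le_sum fun i _ => ?_).trans hdeg
          split
          · have := (htb i).1 ‹_›
            omega
          · exact Nat.zero_le _
        · rw [Nat.testBit_two_pow_of_ne hne, Bool.false_xor] at hk
          exact hbits k hk
      · rw [an_xor, hAf, Finset.sum_insert hd]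
        refine congrArg (fun f : BF n => f + _) (funext fun x => ?_)
        rw [an_two_pow hm64, monomial_eq hmlt, hc, one_mul]
        refine Finset.prod_congr rfl fun i _ => ?_
        by_cases h0 : d i = 0
        · rw [if_neg (by rw [htb]; simpa using h0), h0, pow_zero]
        · rw [if_pos ((htb i).2 h0)]
          have : ∀ c : ZMod 2, c * c = c := by decide
          obtain ⟨e, he⟩ := Nat.exists_eq_succ_of_ne_zero h0
          rw [he]
          clear he
          induction e with
          | zero => simp
          | succ e ih => rw [pow_succ, ← ih, this]
  obtain ⟨A, hA, hb, h⟩ := step _ subset_rfl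
  exact ⟨A, hA, hb, h.trans key.symm⟩

/-- Evaluate the integer `A` before passing it to `P`. -/
def force (A : ℕ) (P : ℕ → Bool) : Bool := Nat.rec (P 0) (fun k _ => P (Nat.succ k)) A

theorem force_eq (A : ℕ) (P : ℕ → Bool) : force A P = P A := by
  cases A <;> rfl

/-- Conjunction of `P` over the coset of `T` spanned by `l`. -/
def allX (l : List ℕ) (P : ℕ → Bool) : ℕ → Bool :=
  List.rec (fun T => force T P) (fun m _ ih T => Bool.rec false (ih (Nat.xor T m)) (ih T)) l

/-- Disjunction of `P` over the coset of `T` spanned by `l`. -/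
def anyX (l : List ℕ) (P : ℕ → Bool) : ℕ → Bool :=
  List.rec (fun T => force T P) (fun m _ ih T => Bool.rec (ih (Nat.xor T m)) true (ih T)) l

theorem allX_sound (E : List ℕ) (P : ℕ → Bool) (T S : ℕ) (hS : ∀ m, S.testBit m = true → m ∈ E)
    (h : allX (E.map (2 ^ ·)) P T = true) : P (T ^^^ S) = true := by
  induction E generalizing T S with
  | nil =>
    have : S = 0 := Nat.eq_of_testBit_eq fun i => by
      have := hS i
      simpa using this
    rw [this, Nat.xor_zero]
    simpa [allX, force_eq] using h
  | cons m E ih =>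
    have h' : allX (E.map (2 ^ ·)) P T = true ∧ allX (E.map (2 ^ ·)) P (T ^^^ 2 ^ m) = true := by
      change (Bool.rec false (allX (E.map (2 ^ ·)) P (T ^^^ 2 ^ m))
        (allX (E.map (2 ^ ·)) P T) : Bool) = true at h
      cases hb : allX (E.map (2 ^ ·)) P T
      · rw [hb] at h
        exact absurd h Bool.false_ne_true
      · rw [hb] at h
        exact ⟨rfl, h⟩
    by_cases hm : S.testBit m = true
    · have := ih (T ^^^ 2 ^ m) (2 ^ m ^^^ S) (fun k hk => by
        rw [Nat.testBit_xor] at hk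
        rcases eq_or_ne m k with rfl | hne
        · simp [hm, Nat.testBit_two_pow_self] at hk
        · rw [Nat.testBit_two_pow_of_ne hne, Bool.false_xor] at hk
          exact (List.mem_cons.1 (hS k hk)).resolve_left hne.symm) h'.2
      rwa [Nat.xor_assoc, ← Nat.xor_assoc (2 ^ m), Nat.xor_self, Nat.zero_xor] at this
    · refine ih T S (fun k hk => (List.mem_cons.1 (hS k hk)).resolve_left ?_) h'.1
      rintro rfl
      exact hm hk

theorem anyX_sound {n : ℕ} (l : List ℕ) (P : ℕ → Bool) (r T : ℕ) (hl : ∀ m ∈ l, tt n m ∈ RM r n)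
    (h : anyX l P T = true) : ∃ S, tt n S ∈ RM r n ∧ P (T ^^^ S) = true := by
  induction l generalizing T with
  | nil =>
    refine ⟨0, ?_, by simpa [anyX, force_eq] using h⟩
    have : tt n 0 = 0 := by
      funext x
      simp [tt, bit]
    rw [this]
    exact RM_zero
  | cons m l ih =>
    have ih := fun T => ih T fun m hm => hl m (List.mem_cons_of_mem _ hm)
    change (Bool.rec (anyX l P (T ^^^ m)) true (anyX l P T) : Bool) = true at h
    cases hb : anyX l P T
    · rw [hb] at h
      obtain ⟨S, hS, hP⟩ := ih _ h
      refine ⟨m ^^^ S, ?_, by rwa [← Nat.xor_assoc]⟩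
      rw [tt_xor]
      exact RM_add (hl m (by simp)) hS
    · exact ih _ hb

/-- Table of the numbers of ones in bytes, with four binary digits for each byte. -/
def popTable : ℕ :=
  95125173855764218123276304889944061997689682402263585766959741291920687686033329201817409157123347502415384089435969498586180241031507595463600295898153685276653211633572815512294064538494957912327413386667662218713394765509704508661031522276467630197481635010039778342554499416459730172574551513689147646224

/-- The number of ones among the `8 * k` lowest binary digits. -/
def pc (k : ℕ) : ℕ → ℕ :=
  Nat.rec (fun _ => 0) (fun _ ih T => Nat.add (Nat.land (Nat.shiftRight popTable
    (Nat.mul 4 (Nat.land T 255))) 15) (ih (Nat.shiftRight T 8))) k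

theorem popTable_spec : ∀ b < 256, Nat.land (Nat.shiftRight popTable (Nat.mul 4 b)) 15 =
    ∑ i ∈ Finset.range 8, (b.testBit i).toNat := by
  decide +kernel

theorem pc_eq (k T : ℕ) : pc k T = ∑ i ∈ Finset.range (8 * k), (T.testBit i).toNat := by
  induction k generalizing T with
  | zero => rfl
  | succ k ih =>
    change Nat.land (Nat.shiftRight popTable (Nat.mul 4 (T &&& 255))) 15 + pc k (T >>> 8) = _
    rw [ih, popTable_spec _ (Nat.and_lt_two_pow (n := 8) _ (by norm_num)), Nat.mul_succ,
      add_comm (8 * k), Finset.sum_range_add]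
    congr 1
    · refine Finset.sum_congr rfl fun i hi => ?_
      rw [Nat.testBit_and, Nat.testBit_two_pow_sub_one 8 i]
      simp [Finset.mem_range.1 hi]
    · simp [Nat.testBit_shiftRight]

theorem hd_tt_zero {n k : ℕ} (hk : 8 * k = 2 ^ n) (T : ℕ) : hd (tt n T) 0 = pc k T := by
  have hb : ∀ b : Bool, b.toNat = if bit b ≠ 0 then 1 else 0 := by decide
  rw [pc_eq, hk, hd, Finset.card_filter]
  refine Finset.sum_bij (fun x _ => idx x) ?_ ?_ ?_ ?_
  · intro x _
    simpa using idx_lt x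
  · intro x _ y _ h
    exact idx_injective h
  · intro j hj
    exact ⟨vec n j, Finset.mem_univ _, idx_vec (by simpa using hj)⟩
  · intro x _
    rw [hb]
    rfl

/-- Action of `x_i ↦ x_i + x_j` (or `x_i ↦ x_i + 1`, when `j = 6`) on indices of points. -/
def shearIdx (i j k : ℕ) : ℕ := k ^^^ bif j == 6 || k.testBit j then 2 ^ i else 0

theorem shearIdx_testBit (i j k l : ℕ) :
    (shearIdx i j k).testBit l = (k.testBit l ^^ ((j == 6 || k.testBit j) && decide (i = l))) := by
  rw [shearIdx, Nat.testBit_xor]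
  cases (j == 6 || k.testBit j) <;> simp [Nat.testBit_two_pow]

theorem shearIdx_lt {n i j k : ℕ} (hi : i < n) (hk : k < 2 ^ n) : shearIdx i j k < 2 ^ n := by
  refine Nat.xor_lt_two_pow hk ?_
  cases (j == 6 || k.testBit j)
  · exact Nat.two_pow_pos n
  · exact Nat.pow_lt_pow_right (by norm_num) hi

theorem shearIdx_shearIdx {i j : ℕ} (hij : i ≠ j) (k : ℕ) :
    shearIdx i j (shearIdx i j k) = k := by
  refine Nat.eq_of_testBit_eq fun l => ?_
  simp only [shearIdx_testBit, hij, decide_false, Bool.and_false, Bool.xor_false]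
  cases k.testBit l <;> cases ((j == 6 || k.testBit j) && decide (i = l)) <;> rfl

/-- The affine permutation `x_i ↦ x_i + x_j` (or `x_i ↦ x_i + 1`, when `j = 6`). -/
def shear (n i j : ℕ) (hi : i < n) (hij : i ≠ j) : (Fin n → ZMod 2) ≃ (Fin n → ZMod 2) where
  toFun x := vec n (shearIdx i j (idx x))
  invFun x := vec n (shearIdx i j (idx x))
  left_inv x := by
    beta_reduce
    rw [idx_vec (shearIdx_lt hi (idx_lt x)), shearIdx_shearIdx hij, vec_idx]
  right_inv x := by
    beta_reduce
    rw [idx_vec (shearIdx_lt hi (idx_lt x)), shearIdx_shearIdx hij, vec_idx]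

theorem idx_shear {n i j : ℕ} (hi : i < n) (hij : i ≠ j) (x : Fin n → ZMod 2) :
    idx (shear n i j hi hij x) = shearIdx i j (idx x) :=
  idx_vec (shearIdx_lt hi (idx_lt x))

theorem isAff_shear {n i j : ℕ} (hi : i < n) (hij : i ≠ j) (hj : j < n ∨ j = 6) :
    IsAff (shear n i j hi hij) := by
  have key : ∀ l : Fin n, (fun x => vec n (shearIdx i j (idx x)) l) ∈ RM 1 n := fun l => by
    have e : (fun x => vec n (shearIdx i j (idx x)) l) = (fun x : Fin n → ZMod 2 => x l) +
        fun x => bit ((j == 6 || (idx x).testBit j) && decide (i = l)) := by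
      funext x
      rw [vec, shearIdx_testBit, bit_xor, bit_testBit_idx]
      rfl
    rw [e]
    refine RM_add (RM_coord l) ?_
    by_cases hil : i = l
    · by_cases h6 : j = 6
      · simpa [h6, hil, bit] using RM_const (r := 1) (n := n) 1
      · have hj : j < n := hj.resolve_right h6
        have h6 : (j == 6) = false := by simpa using h6
        simp only [hil, h6, decide_true, Bool.and_true, Bool.false_or]
        have := RM_coord (⟨j, hj⟩ : Fin n)
        simp only [← bit_testBit_idx _ (⟨j, hj⟩ : Fin n)] at this
        exact this
    · simpa [hil, bit] using RM_const (r := 1) (n := n) 0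
  exact ⟨key, key⟩

/-- A linear operation on integers, to be read as the action of the shear `(i, j)` on algebraic
normal forms. -/
structure Move where
  act : ℕ → ℕ
  hom : XorHom act
  i : ℕ
  j : ℕ

/-- Translation in direction `i`. -/
def Move.trn (i M s : ℕ) : Move where
  act A := Nat.xor A (Nat.shiftRight (Nat.land A M) s)
  hom := xorHom_id.xor ((xorHom_shiftRight s).comp (xorHom_land M))
  i := i
  j := 6

/-- The transvection `x_i ↦ x_i + x_j` for `i < j`. -/
def Move.up (i j M s N t : ℕ) : Move where
  act A := Nat.xor A (Nat.xor (Nat.shiftRight (Nat.land A M) s) (Nat.shiftLeft (Nat.land A N) t))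
  hom := xorHom_id.xor (((xorHom_shiftRight s).comp (xorHom_land M)).xor
    ((xorHom_shiftLeft t).comp (xorHom_land N)))
  i := i
  j := j

/-- The transvection `x_i ↦ x_i + x_j` for `j < i`. -/
def Move.down (i j M s N t : ℕ) : Move where
  act A := Nat.xor A (Nat.xor (Nat.shiftRight (Nat.land A M) s) (Nat.shiftRight (Nat.land A N) t))
  hom := xorHom_id.xor (((xorHom_shiftRight s).comp (xorHom_land M)).xor
    ((xorHom_shiftRight t).comp (xorHom_land N)))
  i := i
  j := j

/-- The positions below `64` whose `i`-th digit vanishes. -/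
def lowMask (i : ℕ) : ℕ := (2 ^ 64 - 1) / (2 ^ 2 ^ i + 1)

theorem lowMask_testBit : ∀ i < 6, ∀ m < 64, (lowMask i).testBit m = !m.testBit i := by
  decide +kernel

/-- The positions below `64` moved by the shear with source `j`. -/
def shearMask (j : ℕ) : ℕ := if j = 6 then 2 ^ 64 - 1 else (2 ^ 64 - 1) ^^^ lowMask j

theorem shearMask_testBit : ∀ j < 7, ∀ k < 64,
    (shearMask j).testBit k = (j == 6 || k.testBit j) := by
  decide +kernel

/-- Exchange the table entries whose positions differ in the `i`-th digit. -/
def swapTable (i T : ℕ) : ℕ :=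
  T >>> 2 ^ i &&& lowMask i ||| (T &&& lowMask i) <<< 2 ^ i

theorem swapTable_testBit {i k : ℕ} (hi : i < 6) (hk : k < 64) (T : ℕ) :
    (swapTable i T).testBit k = T.testBit (k ^^^ 2 ^ i) := by
  have h0 : ∀ i < 6, ∀ k < 64, k.testBit i = false → k ^^^ 2 ^ i = 2 ^ i + k ∧
      (2 ^ i ≤ k → (k - 2 ^ i).testBit i = true) := by decide +kernel
  have h1 : ∀ i < 6, ∀ k < 64, k.testBit i = true → k ^^^ 2 ^ i = k - 2 ^ i ∧
      2 ^ i ≤ k ∧ (k - 2 ^ i).testBit i = false := by decide +kernel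
  rw [swapTable, Nat.testBit_or, Nat.testBit_and, Nat.testBit_shiftRight, Nat.testBit_shiftLeft,
    Nat.testBit_and, lowMask_testBit i hi k hk,
    lowMask_testBit i hi (k - 2 ^ i) ((Nat.sub_le _ _).trans_lt hk)]
  cases hb : k.testBit i
  · obtain ⟨e, h⟩ := h0 i hi k hk hb
    rw [e]
    by_cases hle : 2 ^ i ≤ k
    · simp [h hle]
    · simp [hle]
  · obtain ⟨e, hle, h⟩ := h1 i hi k hk hb
    rw [e]
    simp [hle, h]

/-- Action of the shear `(i, j)` on tables. -/
def shearTable (i j T : ℕ) : ℕ := T ^^^ (shearMask j &&& (T ^^^ swapTable i T))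

theorem shearTable_testBit {i j k : ℕ} (hi : i < 6) (hj : j < 7) (hk : k < 64) (T : ℕ) :
    (shearTable i j T).testBit k = T.testBit (shearIdx i j k) := by
  rw [shearTable, Nat.testBit_xor, Nat.testBit_and, Nat.testBit_xor, swapTable_testBit hi hk,
    shearMask_testBit j hj k hk, shearIdx]
  cases (j == 6 || k.testBit j)
  · simp
  · simp

/-- The operation of `g` is the action of its shear. -/
def Move.Valid (g : Move) : Prop :=
  ∀ m < 64, g.act (2 ^ m) < 2 ^ 64 ∧ mob (g.act (2 ^ m)) = shearTable g.i g.j (mob (2 ^ m))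

instance (g : Move) : Decidable g.Valid := by
  unfold Move.Valid
  infer_instance

/-- The shear of `g` acts on `n` variables. -/
def Move.Fits (n : ℕ) (g : Move) : Prop := g.i < n ∧ g.i ≠ g.j ∧ (g.j < n ∨ g.j = 6)

instance (n : ℕ) (g : Move) : Decidable (g.Fits n) := by
  unfold Move.Fits
  infer_instance

theorem Move.act_lt {g : Move} (hg : g.Valid) : ∀ A < 2 ^ 64, g.act A < 2 ^ 64 :=
  g.hom.lt_of_basis fun m hm => (hg m hm).1

theorem Move.exists_isAff {n : ℕ} (hn : n ≤ 6) {g : Move} (hg : g.Valid) (hfit : g.Fits n) :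
    ∃ σ, IsAff σ ∧ ∀ A < 2 ^ 64, an n (g.act A) = an n A ∘ σ := by
  obtain ⟨hi, hij, hj⟩ := hfit
  refine ⟨shear n g.i g.j hi hij, isAff_shear hi hij hj, xor_induction 64 ?_ ?_ ?_⟩
  · rw [g.hom.map_zero, an_zero]
    rfl
  · intro a b ha hb
    rw [g.hom, an_xor, an_xor, ha, hb]
    rfl
  · intro m hm
    rw [an_eq_tt hn _ (hg m hm).1]
    funext x
    rw [tt, (hg m hm).2, shearTable_testBit (by omega) (by omega) (idx_lt64 hn x),
      Function.comp_apply, an_two_pow hm, idx_shear hi hij, mob_two_pow_testBit m hm]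
    exact (shearIdx_lt (hi.trans_le hn) (idx_lt64 hn x))

/-- Try all compositions of `d` moves, keeping only the digits in `H` after each of them. -/
def search (L : List Move) (H : ℕ) (leaf : ℕ → Bool) (d : ℕ) : ℕ → Bool :=
  Nat.rec leaf (fun _ ih B => List.rec false (fun g _ next =>
    Bool.rec next true (force (Nat.land (g.act B) H) ih)) L) d

/-- The digits outside `H` correspond to monomials of degree at most `r`. -/
def Drops (n r H : ℕ) : Prop := ∀ m < 64, H.testBit m = false → m < 2 ^ n → bw m ≤ r

theorem AffInv.of_land {n r H : ℕ} {P : BF n → Prop} (hP : AffInv r P) (hn : n ≤ 6)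
    (hH : Drops n r H) (A : ℕ) (h : P (an n (A &&& H))) : P (an n A) := by
  have e : an n A + an n (A ^^^ (A &&& H)) = an n (A &&& H) := by
    rw [← an_xor, ← Nat.xor_assoc, Nat.xor_self, Nat.zero_xor]
  refine hP.of_add (an_mem_RM hn fun m hm hb hlt => hH m hm ?_ hlt) (e ▸ h)
  rw [Nat.testBit_xor, Nat.testBit_and] at hb
  revert hb
  cases A.testBit m <;> cases H.testBit m <;> decide

theorem search_succ {L : List Move} {H d B : ℕ} {leaf : ℕ → Bool}
    (h : search L H leaf (d + 1) B = true) :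
    ∃ g ∈ L, search L H leaf d (g.act B &&& H) = true := by
  have key : ∀ L' : List Move, (List.rec false (fun g _ next =>
      Bool.rec next true (force (Nat.land (g.act B) H) (search L H leaf d))) L' : Bool) = true →
      ∃ g ∈ L', search L H leaf d (g.act B &&& H) = true := by
    intro L'
    induction L' with
    | nil => exact fun h => absurd h Bool.false_ne_true
    | cons g L' ih =>
      intro h
      cases hb : search L H leaf d (g.act B &&& H)
      · have hb' : force (Nat.land (g.act B) H) (search L H leaf d) = false := by
          rw [force_eq]
          exact hb
        simp only [hb'] at h
        obtain ⟨g', hg', h'⟩ := ih h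
        exact ⟨g', List.mem_cons_of_mem _ hg', h'⟩
      · exact ⟨g, by simp, hb⟩
  exact key L h

theorem search_sound {n r H : ℕ} (hn : n ≤ 6) (hH : Drops n r H) {L : List Move}
    (hL : ∀ g ∈ L, g.Valid ∧ g.Fits n) {leaf : ℕ → Bool} (d : ℕ) {B : ℕ} (hB : B < 2 ^ 64)
    (h : search L H leaf d B = true) (hBH : d = 0 → B &&& H = B) :
    ∃ B' < 2 ^ 64, B' &&& H = B' ∧ leaf B' = true ∧
      ∀ P : BF n → Prop, AffInv r P → P (an n B') → P (an n B) := by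
  induction d generalizing B with
  | zero => exact ⟨B, hB, hBH rfl, h, fun _ _ hP => hP⟩
  | succ d ih =>
    obtain ⟨g, hg, hs⟩ := search_succ h
    obtain ⟨hval, hfit⟩ := hL g hg
    have hlt := Move.act_lt hval B hB
    obtain ⟨B', hB', hm, hl, himp⟩ := ih (Nat.and_le_left.trans_lt hlt) hs fun _ => by
      rw [Nat.and_assoc, Nat.and_self]
    refine ⟨B', hB', hm, hl, fun P hP h' => ?_⟩
    obtain ⟨σ, hσ, hact⟩ := Move.exists_isAff hn hval hfit
    have := hP.of_land hn hH _ (himp P hP h')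
    rw [hact B hB] at this
    exact hP.of_comp hσ this

/-- Every coset `T + q` with `q` in the span of the digits `Q` either can be replaced by a smaller
one or is within distance `k` of an affine function. -/
def covCheck (L : List Move) (H₁ H₂ : ℕ) (Q aff : List ℕ) (bytes k T : ℕ) : Bool :=
  allX (Q.map (2 ^ ·)) (fun B => Bool.rec
    (force (mob B) (anyX aff fun U => Nat.ble (pc bytes U) k)) true
    (search L H₁ (fun B' => Bool.rec false (Nat.beq (Nat.land B' H₂) T) (Nat.ble (Nat.succ B') B))
      1 B)) T

theorem covCheck_sound {n H₁ H₂ bytes k T : ℕ} (hn : n ≤ 6) (hb : 8 * bytes = 2 ^ n)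
    (h₁ : Drops n 1 H₁) (h₂ : ∀ m < 64, H₂.testBit m = true → 3 ≤ bw m) {L : List Move}
    (hL : ∀ g ∈ L, g.Valid ∧ g.Fits n) {Q aff : List ℕ}
    (hQ : ∀ m < 64, H₁.testBit m = true → H₂.testBit m = false → m ∈ Q)
    (haff : ∀ m ∈ aff, tt n m ∈ RM 1 n) (hT : T < 2 ^ 64) (hT₁ : T &&& H₁ = T) (hT₂ : T &&& H₂ = T)
    (h : covCheck L H₁ H₂ Q aff bytes k T = true) : Covered k (an n T) := by
  have main : ∀ B, B < 2 ^ 64 → B &&& H₁ = B → B &&& H₂ = T → ∃ a ∈ RM 1 n, hd (an n B) a ≤ k := by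
    intro B
    induction B using Nat.strong_induction_on with
    | _ B ih =>
      intro hB hB₁ hB₂
      have hS : ∀ m, (T ^^^ B).testBit m = true → m ∈ Q := fun m hm => by
        have hm64 : m < 64 := by
          by_contra hc
          have hle : 2 ^ 64 ≤ 2 ^ m := Nat.pow_le_pow_right (by norm_num) (by omega)
          rw [Nat.testBit_lt_two_pow ((Nat.xor_lt_two_pow hT hB).trans_le hle)] at hm
          exact Bool.false_ne_true hm
        have e₁ : (B.testBit m && H₁.testBit m) = B.testBit m := by rw [← Nat.testBit_and, hB₁]
        have e₂ : (B.testBit m && H₂.testBit m) = T.testBit m := by rw [← Nat.testBit_and, hB₂]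
        rw [Nat.testBit_xor] at hm
        refine hQ m hm64 ?_ ?_ <;> revert hm e₁ e₂ <;> cases B.testBit m <;> cases T.testBit m <;>
          cases H₁.testBit m <;> cases H₂.testBit m <;> decide
      have hp := allX_sound Q _ T _ hS h
      rw [← Nat.xor_assoc, Nat.xor_self, Nat.zero_xor] at hp
      cases hs : search L H₁ (fun B' => Bool.rec false (Nat.beq (Nat.land B' H₂) T)
          (Nat.ble (Nat.succ B') B)) 1 B
      · rw [hs] at hp
        have hp : force _ _ = true := hp
        rw [force_eq] at hp
        obtain ⟨S, hS, hle⟩ := anyX_sound aff _ 1 _ haff hp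
        refine ⟨tt n S, hS, ?_⟩
        have hle := Nat.le_of_ble_eq_true hle
        rw [← hd_tt_zero hb, tt_xor, ← an_eq_tt hn B hB, hd_add_swap, zero_add] at hle
        exact hle
      · obtain ⟨B', hlt, hm, hl, himp⟩ := search_sound hn h₁ hL 1 hB hs (by simp)
        cases hle : Nat.ble (Nat.succ B') B
        · rw [hle] at hl
          exact absurd hl Bool.false_ne_true
        · rw [hle] at hl
          exact himp _ (inv_near_affine k)
            (ih B' (Nat.le_of_ble_eq_true hle) hlt hm (Nat.eq_of_beq_eq_true hl))
  intro q hq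
  obtain ⟨A, hA, hbits, rfl⟩ := exists_an_of_RM hn hq
  rw [← an_xor]
  refine (inv_near_affine k).of_land hn h₁ _ (main _
    (Nat.and_le_left.trans_lt (Nat.xor_lt_two_pow hT hA)) (by rw [Nat.and_assoc, Nat.and_self]) ?_)
  refine Nat.eq_of_testBit_eq fun m => ?_
  have e₁ : (T.testBit m && H₁.testBit m) = T.testBit m := by rw [← Nat.testBit_and, hT₁]
  have e₂ : (T.testBit m && H₂.testBit m) = T.testBit m := by rw [← Nat.testBit_and, hT₂]
  have e₃ : A.testBit m = true → H₂.testBit m = false := fun hm => by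
    obtain ⟨hlt, hw⟩ := hbits m hm
    have hm64 := hlt.trans_le (Nat.pow_le_pow_right (n := 2) (by norm_num) hn)
    cases hc : H₂.testBit m
    · rfl
    · have := h₂ m hm64 hc
      omega
  rw [Nat.testBit_and, Nat.testBit_and, Nat.testBit_xor]
  revert e₁ e₂ e₃
  cases A.testBit m <;> cases T.testBit m <;> cases H₁.testBit m <;> cases H₂.testBit m <;> decide

theorem near_of_pc {n bytes k Q T : ℕ} (hn : n ≤ 6) (hb : 8 * bytes = 2 ^ n) (hT : T < 2 ^ 64)
    (hQ : Q < 2 ^ 64) (hQ₂ : ∀ m < 64, Q.testBit m = true → bw m ≤ 2)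
    (h : pc bytes (mob (T ^^^ Q)) ≤ k) : Near k (an n T) := by
  refine ⟨an n Q, an_mem_RM hn fun m hm hb _ => hQ₂ m hm hb, ?_⟩
  rwa [← hd_tt_zero hb, ← an_eq_tt hn _ (Nat.xor_lt_two_pow hT hQ), an_xor, hd_add_swap,
    zero_add] at h

/-- The translations of the first five coordinates. -/
def translations : List Move :=
  [Move.trn 0 12297829382473034410 1, Move.trn 1 14757395258967641292 2,
    Move.trn 2 17361641481138401520 4, Move.trn 3 18374966859414961920 8,
    Move.trn 4 18446462603027742720 16]

/-- The transvections of the first five coordinates. -/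
def transvections : List Move :=
  [Move.up 0 1 9838263505978427528 1 2459565876494606882 1,
    Move.up 0 2 11574427654092267680 1 723401728380766730 3,
    Move.up 0 3 12249977906276641280 1 47851476196393130 7,
    Move.up 0 4 12297641735351828480 1 187647121205930 15,
    Move.down 1 0 9838263505978427528 2 4919131752989213764 1,
    Move.up 1 2 13889313184910721216 2 868082074056920076 2,
    Move.up 1 3 14699973487531969536 2 57421771435671756 6,
    Move.up 1 4 14757170082422194176 2 225176545447116 14,
    Move.down 2 0 11574427654092267680 4 5787213827046133840 3,
    Move.down 2 1 13889313184910721216 4 3472328296227680304 2,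
    Move.up 2 3 17294086455919964160 4 67555025218437360 4,
    Move.up 2 4 17361376567555522560 4 264913582878960 12,
    Move.down 3 0 12249977906276641280 8 6124988953138320640 7,
    Move.down 3 1 14699973487531969536 8 3674993371882992384 6,
    Move.down 3 2 17294086455919964160 8 1080880403494997760 4,
    Move.up 3 4 18374686483949813760 8 280375465148160 8,
    Move.down 4 0 12297641735351828480 16 6148820867675914240 15,
    Move.down 4 1 14757170082422194176 16 3689292520605548544 14,
    Move.down 4 2 17361376567555522560 16 1085086035472220160 12,
    Move.down 4 3 18374686483949813760 16 71776119077928960 8]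

theorem translations_valid : ∀ g ∈ translations, g.Valid ∧ g.Fits 5 := by
  decide +kernel

theorem transvections_valid : ∀ g ∈ transvections, g.Valid ∧ g.Fits 5 := by
  decide +kernel

/-- Generators of the affine group in five variables. -/
def moves5 : List Move := translations ++ transvections

theorem moves5_valid : ∀ g ∈ moves5, g.Valid ∧ g.Fits 5 := fun g hg =>
  (List.mem_append.1 hg).elim (translations_valid g) (transvections_valid g)

/-- Exponents of the monomials of degree two in five variables. -/
def quad5 : List ℕ := [3, 5, 6, 9, 10, 12, 17, 18, 20, 24]

/-- Exponents of the monomials of degree at least three in five variables. -/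
def high5 : List ℕ := [7, 11, 13, 14, 15, 19, 21, 22, 23, 25, 26, 27, 28, 29, 30, 31]

/-- Tables of the affine functions `1, x_0, …, x_4`. -/
def affine5 : List ℕ :=
  [18446744073709551615, 12297829382473034410, 14757395258967641292, 17361641481138401520,
    18374966859414961920, 18446462603027742720]

theorem affine_table {n r : ℕ} (hn : n ≤ 6) {l : List ℕ} (hl : ∀ m ∈ l, m < 64 ∧ bw m ≤ r) :
    ∀ T ∈ l.map (fun m => mob (2 ^ m)), tt n T ∈ RM r n := by
  intro T hT
  obtain ⟨m, hm, rfl⟩ := List.mem_map.1 hT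
  obtain ⟨hm64, hw⟩ := hl m hm
  rw [← an_eq_tt hn _ (Nat.pow_lt_pow_right (by norm_num) hm64)]
  refine an_mem_RM hn fun k _ hk _ => ?_
  rw [Nat.testBit_two_pow] at hk
  simp only [decide_eq_true_eq] at hk
  exact hk ▸ hw

theorem affine5_mem : ∀ T ∈ affine5, tt 5 T ∈ RM 1 5 := by
  rw [show affine5 = [0, 1, 2, 4, 8, 16].map (fun m => mob (2 ^ m)) by decide +kernel]
  exact affine_table (by norm_num) (by decide +kernel)

theorem drops5_one : Drops 5 1 4294901480 := by
  unfold Drops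
  decide +kernel

theorem drops5_two : Drops 5 2 4276676736 := by
  unfold Drops
  decide +kernel

theorem covered5 {k T : ℕ} (hT : T < 2 ^ 64) (hT₁ : T &&& 4294901480 = T)
    (hT₂ : T &&& 4276676736 = T)
    (h : covCheck moves5 4294901480 4276676736 quad5 affine5 4 k T = true) : Covered k (an 5 T) :=
  covCheck_sound (by norm_num) (by norm_num) drops5_one (by decide +kernel) moves5_valid
    (by decide +kernel) affine5_mem hT hT₁ hT₂ h

theorem covered5_zero : Covered 12 (an 5 0) :=
  covered5 (by norm_num) (by decide +kernel) (by decide +kernel) (by decide +kernel)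

theorem covered5_cubic : Covered 12 (an 5 128) :=
  covered5 (by norm_num) (by decide +kernel) (by decide +kernel) (by decide +kernel)

theorem covered5_quartic : Covered 12 (an 5 32768) :=
  covered5 (by norm_num) (by decide +kernel) (by decide +kernel) (by decide +kernel)

theorem covered5_two_cubics : Covered 12 (an 5 532480) :=
  covered5 (by norm_num) (by decide +kernel) (by decide +kernel) (by decide +kernel)

theorem covered5_cubic_quartic : Covered 12 (an 5 557056) :=
  covered5 (by norm_num) (by decide +kernel) (by decide +kernel) (by decide +kernel)

theorem covered5_two_cubics_quartic : Covered 10 (an 5 37781504) :=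
  covered5 (by norm_num) (by decide +kernel) (by decide +kernel) (by decide +kernel)

theorem covered5_quintic : Covered 12 (an 5 2147483648) :=
  covered5 (by norm_num) (by decide +kernel) (by decide +kernel) (by decide +kernel)

theorem covered5_cubic_quintic : Covered 12 (an 5 2147483776) :=
  covered5 (by norm_num) (by decide +kernel) (by decide +kernel) (by decide +kernel)

theorem covered5_two_cubics_quintic : Covered 11 (an 5 2148016128) :=
  covered5 (by norm_num) (by decide +kernel) (by decide +kernel) (by decide +kernel)

/-- Equivalence to the sum of two cubic monomials with a common factor, modulo quadratics. -/
def TwoCubics (f : BF 5) : Prop := ∃ σ, IsAff σ ∧ f ∘ σ + an 5 532480 ∈ RM 2 5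

theorem inv_twoCubics : AffInv 2 TwoCubics where
  add := fun f q hq ⟨σ, hσ, h⟩ => ⟨σ, hσ, by
    have e : (f + q) ∘ σ = f ∘ σ + q ∘ σ := rfl
    rw [e, add_right_comm]
    exact RM_add h (RM_comp_aff hq hσ)⟩
  comp := fun f τ hτ ⟨σ, hσ, h⟩ => ⟨σ.trans τ.symm, hσ.trans hτ.symm, by
    have e : (f ∘ τ) ∘ (σ.trans τ.symm) = f ∘ σ := by
      funext x
      simp
    rwa [e]⟩

/-- The possible behaviours of a coset of quadratic functions in five variables. -/
def Kind5 (f : BF 5) : Prop :=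
  Covered 12 f ∧ (Near 4 f ∨ (Near 6 f ∧ Covered 10 f) ∨ (Near 5 f ∧ Covered 11 f) ∨
    (Near 6 f ∧ TwoCubics f))

theorem inv_kind5 : AffInv 2 Kind5 :=
  (inv_covered 12).and ((inv_near 4).or (((inv_near 6).and (inv_covered 10)).or
    (((inv_near 5).and (inv_covered 11)).or ((inv_near 6).and inv_twoCubics))))

theorem near5 {k Q T : ℕ} (hT : T < 2 ^ 64) (hQ : Q < 2 ^ 64)
    (hQ₂ : ∀ m < 64, Q.testBit m = true → bw m ≤ 2) (h : pc 4 (mob (T ^^^ Q)) ≤ k) :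
    Near k (an 5 T) :=
  near_of_pc (by norm_num) (by norm_num) hT hQ hQ₂ h

theorem Covered.mono {n k l : ℕ} (h : k ≤ l) {f : BF n} (hf : Covered k f) : Covered l f :=
  fun q hq => (hf q hq).imp fun _ ha => ⟨ha.1, ha.2.trans h⟩

/-- Representatives of the cosets of quadratic functions in five variables. -/
def reps5 : List ℕ :=
  [0, 128, 32768, 532480, 557056, 37781504, 2147483648, 2147483776, 2148016128]

theorem kind5_rep : ∀ A ∈ reps5, Kind5 (an 5 A) := by
  intro A hA
  simp only [reps5, List.mem_cons, List.not_mem_nil, or_false] at hA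
  rcases hA with rfl | rfl | rfl | rfl | rfl | rfl | rfl | rfl | rfl
  · exact ⟨covered5_zero, .inl
      (near5 (Q := 0) (by norm_num) (by norm_num) (by decide +kernel) (by decide +kernel))⟩
  · exact ⟨covered5_cubic, .inl
      (near5 (Q := 0) (by norm_num) (by norm_num) (by decide +kernel) (by decide +kernel))⟩
  · exact ⟨covered5_quartic, .inl
      (near5 (Q := 0) (by norm_num) (by norm_num) (by decide +kernel) (by decide +kernel))⟩
  · exact ⟨covered5_two_cubics, .inr (.inr (.inr
      ⟨near5 (Q := 0) (by norm_num) (by norm_num) (by decide +kernel) (by decide +kernel),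
        Equiv.refl _, ⟨RM_coord, RM_coord⟩, by
          rw [Equiv.coe_refl, Function.comp_id, BF_add_self]
          exact RM_zero⟩))⟩
  · exact ⟨covered5_cubic_quartic, .inl
      (near5 (Q := 0) (by norm_num) (by norm_num) (by decide +kernel) (by decide +kernel))⟩
  · exact ⟨covered5_two_cubics_quartic.mono (by norm_num), .inr (.inl
      ⟨near5 (Q := 64) (by norm_num) (by norm_num) (by decide +kernel) (by decide +kernel),
        covered5_two_cubics_quartic⟩)⟩
  · exact ⟨covered5_quintic, .inl
      (near5 (Q := 0) (by norm_num) (by norm_num) (by decide +kernel) (by decide +kernel))⟩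
  · exact ⟨covered5_cubic_quintic, .inl
      (near5 (Q := 0) (by norm_num) (by norm_num) (by decide +kernel) (by decide +kernel))⟩
  · exact ⟨covered5_two_cubics_quintic.mono (by norm_num), .inr (.inr (.inl
      ⟨near5 (Q := 8) (by norm_num) (by norm_num) (by decide +kernel) (by decide +kernel),
        covered5_two_cubics_quintic⟩))⟩

/-- Either `A` is a representative or a few moves turn it into a smaller integer. -/
def reduces5 (A : ℕ) : Bool :=
  search moves5 4276676736 (fun C => Nat.ble (Nat.succ C) A) 1 A || (List.elem A reps5 ||
    (search moves5 4276676736 (fun C => Nat.ble (Nat.succ C) A) 2 A ||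
      search moves5 4276676736 (fun C => Nat.ble (Nat.succ C) A) 3 A))

theorem reduces5_all : allX (high5.map (2 ^ ·)) reduces5 0 = true := by
  decide +kernel

theorem kind5 (f : BF 5) : Kind5 f := by
  obtain ⟨A, hA, rfl⟩ := exists_an (by norm_num) f
  refine inv_kind5.of_land (by norm_num) drops5_two A ?_
  suffices h : ∀ B, B < 2 ^ 64 → B &&& 4276676736 = B → Kind5 (an 5 B) from
    h _ (Nat.and_le_left.trans_lt hA) (by rw [Nat.and_assoc, Nat.and_self])
  intro B
  induction B using Nat.strong_induction_on with
  | _ B ih =>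
    intro hB hm
    have step : ∀ d, d ≠ 0 → search moves5 4276676736 (fun C => Nat.ble (Nat.succ C) B) d B = true →
        Kind5 (an 5 B) := by
      intro d hd hs
      obtain ⟨B', hlt, hm', hl, himp⟩ := search_sound (by norm_num) drops5_two moves5_valid d hB hs
        fun h => absurd h hd
      have hle := Nat.le_of_ble_eq_true hl
      exact himp _ inv_kind5 (ih B' hle hlt hm')
    have hp := allX_sound high5 reduces5 0 B (fun m hmb => ?_) reduces5_all
    · rw [Nat.zero_xor, reduces5, Bool.or_eq_true, Bool.or_eq_true, Bool.or_eq_true] at hp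
      rcases hp with h | h | h | h
      · exact step 1 (by norm_num) h
      · exact kind5_rep B (List.elem_iff.1 h)
      · exact step 2 (by norm_num) h
      · exact step 3 (by norm_num) h
    · rw [← hm, Nat.testBit_and, Bool.and_eq_true] at hmb
      have h64 : m < 64 := by
        by_contra hc
        have hle : 2 ^ 64 ≤ 2 ^ m := Nat.pow_le_pow_right (by norm_num) (by omega)
        rw [Nat.testBit_lt_two_pow (hB.trans_le hle)] at hmb
        exact Bool.false_ne_true hmb.1
      have key : ∀ m < 64, (4276676736).testBit m = true → m ∈ high5 := by decide +kernel
      exact key m h64 hmb.2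

/-- The translations in six variables. -/
def translations6 : List Move := translations ++ [Move.trn 5 18446744069414584320 32]

/-- The transvections in six variables. -/
def transvections6 : List Move := transvections ++
  [Move.up 0 5 12297829379609722880 1 2863311530 31,
    Move.up 1 5 14757395255531667456 2 3435973836 30,
    Move.up 2 5 17361641477096079360 4 4042322160 28,
    Move.up 3 5 18374966855136706560 8 4278255360 24,
    Move.up 4 5 18446462598732840960 16 4294901760 16,
    Move.down 5 0 12297829379609722880 32 6148914689804861440 31,
    Move.down 5 1 14757395255531667456 32 3689348813882916864 30,
    Move.down 5 2 17361641477096079360 32 1085102592318504960 28,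
    Move.down 5 3 18374966855136706560 32 71777214277877760 24,
    Move.down 5 4 18446462598732840960 32 281470681743360 16]

theorem translations6_valid : ∀ g ∈ translations6, g.Valid ∧ g.Fits 6 := by
  decide +kernel

theorem transvections6_valid : ∀ g ∈ transvections6, g.Valid ∧ g.Fits 6 := by
  decide +kernel

/-- Exponents of the monomials of degree two in six variables. -/
def quad6 : List ℕ := [3, 5, 6, 9, 10, 12, 17, 18, 20, 24, 33, 34, 36, 40, 48]

/-- Tables of the affine functions `1, x_0, …, x_5`. -/
def affine6 : List ℕ :=
  [18446744073709551615, 12297829382473034410, 14757395258967641292, 17361641481138401520,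
    18374966859414961920, 18446462603027742720, 18446744069414584320]

theorem affine6_mem : ∀ T ∈ affine6, tt 6 T ∈ RM 1 6 := by
  rw [show affine6 = [0, 1, 2, 4, 8, 16, 32].map (fun m => mob (2 ^ m)) by decide +kernel]
  exact affine_table le_rfl (by decide +kernel)

theorem drops6_one : Drops 6 1 18446744069414518504 := by
  unfold Drops
  decide +kernel

theorem drops6_two : Drops 6 2 18446461400418674816 := by
  unfold Drops
  decide +kernel

theorem tt_two_pow {n : ℕ} (p : Fin n → ZMod 2) : tt n (2 ^ idx p) = pt p := by
  funext x
  rw [tt, pt, Nat.testBit_two_pow, bit]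
  simp only [decide_eq_true_eq, idx_injective.eq_iff]
  exact if_congr eq_comm rfl rfl

theorem near6 {T : ℕ} (hT : T < 2 ^ 64) (l : List ℕ)
    (hl : ∀ Q ∈ l, Q < 2 ^ 64 ∧ ∀ m < 64, Q.testBit m = true → bw m ≤ 2)
    (h₀ : ∃ Q ∈ l, pc 8 (mob (T ^^^ Q)) ≤ 16)
    (h : ∀ k < 64, ∃ Q ∈ l, pc 8 (mob (T ^^^ Q) ^^^ 2 ^ k) ≤ 16) : DichPt (an 6 T) := by
  constructor
  · obtain ⟨Q, hQ, hle⟩ := h₀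
    exact .inl (near_of_pc le_rfl (by norm_num) hT (hl Q hQ).1 (hl Q hQ).2 hle)
  · intro p
    obtain ⟨Q, hQ, hle⟩ := h _ (idx_lt p)
    refine .inl ⟨an 6 Q, an_mem_RM le_rfl fun m hm hb _ => (hl Q hQ).2 m hm hb, ?_⟩
    rwa [← hd_tt_zero (n := 6) (by norm_num), tt_xor, tt_two_pow,
      ← an_eq_tt le_rfl _ (Nat.xor_lt_two_pow hT (hl Q hQ).1), an_xor, add_right_comm,
      hd_add_swap, zero_add] at hle

theorem dichPt_of_covered {f : BF 6} (h : Covered 22 f) : DichPt f := by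
  refine ⟨.inr (h.mono (by norm_num)), fun p => .inr fun q hq => ?_⟩
  obtain ⟨a, ha, hle⟩ := h q hq
  refine ⟨a, ha, ?_⟩
  rw [add_right_comm]
  exact (hd_add_pt _ _ _).trans (Nat.succ_le_succ hle)

theorem dichPt_cubic₁ : DichPt (an 6 532480) :=
  near6 (by norm_num) [0] (by decide +kernel) (by decide +kernel) (by decide +kernel)

theorem dichPt_cubic₂ : DichPt (an 6 34628173824) :=
  near6 (by norm_num) [0] (by decide +kernel) (by decide +kernel) (by decide +kernel)

theorem dichPt_cubic₃ : DichPt (an 6 34361851904) :=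
  near6 (by norm_num) [8, 96, 30066021632, 30066021737] (by decide +kernel) (by decide +kernel)
    (by decide +kernel)

theorem dichPt_cubic₄ : DichPt (an 6 2473974562816) :=
  dichPt_of_covered (covCheck_sound (bytes := 8) (L := translations6) (Q := quad6) (aff := affine6)
    (H₁ := 18446744069414518504) (H₂ := 18446461400418674816) le_rfl
    (by norm_num) drops6_one (by decide +kernel) translations6_valid (by decide +kernel)
    affine6_mem (by norm_num) (by decide +kernel) (by decide +kernel) (by decide +kernel))

/-- Follow decreasing compositions of `d` moves until an integer satisfying `leaf` is met. -/
def descend (L : List Move) (H : ℕ) (leaf : ℕ → Bool) (d fuel : ℕ) : ℕ → Bool :=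
  Nat.rec leaf (fun _ ih A =>
    search L H (fun B => Bool.rec false (ih B) (Nat.ble (Nat.succ B) A)) d A || leaf A) fuel

theorem descend_sound {n r H : ℕ} (hn : n ≤ 6) (hH : Drops n r H) {L : List Move}
    (hL : ∀ g ∈ L, g.Valid ∧ g.Fits n) {leaf : ℕ → Bool} {P : BF n → Prop} (hP : AffInv r P)
    (hleaf : ∀ B, leaf B = true → P (an n B)) (d fuel : ℕ) {A : ℕ} (hA : A < 2 ^ 64)
    (hm : A &&& H = A) (h : descend L H leaf d fuel A = true) : P (an n A) := by
  induction fuel generalizing A with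
  | zero => exact hleaf A h
  | succ fuel ih =>
    change (search L H (fun B => Bool.rec false (descend L H leaf d fuel B)
      (Nat.ble (Nat.succ B) A)) d A || leaf A) = true at h
    rw [Bool.or_eq_true] at h
    rcases h with h | h
    · obtain ⟨B, hB, hBm, hl, himp⟩ := search_sound hn hH hL d hA h fun _ => hm
      refine himp P hP (ih hB hBm ?_)
      cases hc : Nat.ble (Nat.succ B) A <;> rw [hc] at hl
      · exact absurd hl Bool.false_ne_true
      · exact hl
    · exact hleaf A h

/-- Cubic forms in six variables whose restriction to the hyperplane `x_5 = 0` is fixed. -/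
def cubics6 : List ℕ :=
  [532480, 540672, 2113536, 4202496, 33570816, 37748736, 67117056, 69206016, 268959744,
    34361851904, 34363940864, 34393309184, 34397487104, 34426855424, 34428944384, 34628173824,
    137439494144, 137443149824, 137472524288, 137476702208, 137506062336, 137707913216,
    274878439424, 274880006144, 274911461376, 274945024000, 274947112960, 275146866688,
    2199023796224, 2199025369088, 2199027449856, 2199090364544, 2199092461568, 2199292215296,
    2473968271360, 2473970368512, 2473972465664, 2473974562816, 2474169597952, 2474170122240,
    2474174316544, 4398047043584, 4398048608256, 4398050713600, 4398315470848, 4535521116160,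
    4535523213312, 4535525310464, 4535753900032, 4535754424320, 4535755997184, 4535756521472,
    17592186568704, 17626548404224, 17626550501376, 17626579861504, 17626584055808,
    17626613415936, 17626615513088, 562949957623808, 562950020538368, 563224898437120,
    563224898445312, 563224898461696, 563225099763712, 563225099782144, 567348004126720,
    567348004134912, 567348004151296, 567348268367872, 567348268384384, 580542143660032,
    580542143676416, 580542143678464, 580542206574592, 580542206590976, 580542206591104,
    1126037379375104, 1128098932219904, 1143492094984192, 1143492094994432, 1143492126441472,
    1143492126449792, 4503599627902976, 4503634020679680, 4503634054225920, 4505798651166720,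
    4507997674414080, 72057594038460416, 72057628399779840, 72057628401868800, 72057731477422080,
    72057868916367360]

theorem dichPt_cubics6 : ∀ A ∈ cubics6, DichPt (an 6 A) := by
  have key : ∀ A ∈ cubics6, A < 2 ^ 64 ∧ A &&& 18446461400418674816 = A ∧
      descend transvections6 18446461400418674816
        (List.elem · [532480, 34628173824, 34361851904, 2473974562816]) 2 20 A = true := by
    decide +kernel
  intro A hA
  obtain ⟨hlt, hm, h⟩ := key A hA
  refine descend_sound le_rfl drops6_two transvections6_valid inv_dichPt (fun B hB => ?_) 2 20 hlt
    hm h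
  have hB := List.elem_iff.1 hB
  simp only [List.mem_cons, List.not_mem_nil, or_false] at hB
  rcases hB with rfl | rfl | rfl | rfl
  · exact dichPt_cubic₁
  · exact dichPt_cubic₂
  · exact dichPt_cubic₃
  · exact dichPt_cubic₄

/-- Exponents of the monomials of degree three in six variables divisible by `x_5`. -/
def cubicExt : List ℕ := [35, 37, 38, 41, 42, 44, 49, 50, 52, 56]

theorem dichPt_extension {S : ℕ} (hS : ∀ m, S.testBit m = true → m ∈ cubicExt)
    (hlt : 532480 ^^^ S < 2 ^ 64) (hm : (532480 ^^^ S) &&& 18446461400418674816 = 532480 ^^^ S) :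
    DichPt (an 6 (532480 ^^^ S)) := by
  have key : allX (cubicExt.map (2 ^ ·)) (descend transvections6 18446461400418674816
      (List.elem · cubics6) 1 64) 532480 = true := by
    decide +kernel
  exact descend_sound le_rfl drops6_two transvections6_valid inv_dichPt
    (fun B hB => dichPt_cubics6 B (List.elem_iff.1 hB)) 1 64 hlt hm (allX_sound _ _ _ _ hS key)

/-- Restriction of `F` to the hyperplane `x_i = c`. -/
def face {n : ℕ} (i : Fin (n + 1)) (c : ZMod 2) (F : BF (n + 1)) : BF n :=
  fun y => F (i.insertNth c y)

/-- The function with restrictions `g` and `h` to `x_i = 0` and `x_i = 1`. -/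
def glue {n : ℕ} (i : Fin (n + 1)) (g h : BF n) : BF (n + 1) :=
  fun x => (1 + x i) * g (i.removeNth x) + x i * h (i.removeNth x)

theorem RM_removeNth {r n : ℕ} (i : Fin (n + 1)) {g : BF n} (hg : g ∈ RM r n) :
    (fun x => g (i.removeNth x) : BF (n + 1)) ∈ RM r (n + 1) :=
  RM_comp hg fun j => RM_coord (i.succAbove j)

theorem face_zero_glue {n : ℕ} (i : Fin (n + 1)) (g h : BF n) : face i 0 (glue i g h) = g := by
  funext y
  simp [face, glue]

theorem face_one_glue {n : ℕ} (i : Fin (n + 1)) (g h : BF n) : face i 1 (glue i g h) = h := by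
  funext y
  simp [face, glue, CharTwo.add_self_eq_zero]

theorem hd_eq_add_face {n : ℕ} (i : Fin (n + 1)) (F G : BF (n + 1)) :
    hd F G = hd (face i 0 F) (face i 0 G) + hd (face i 1 F) (face i 1 G) := by
  simp only [hd, Finset.card_filter]
  rw [← Equiv.sum_comp (Fin.insertNthEquiv (fun _ => ZMod 2) i), Fintype.sum_prod_type]
  exact Fin.sum_univ_two _

theorem exists_near_glue {n k l : ℕ} (i : Fin (n + 1)) (f f' : BF n) {q a : BF n}
    (hq : q ∈ RM 2 n) (ha : a ∈ RM 1 n) (h : hd f q ≤ k) (h' : hd f' (q + a) ≤ l) :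
    Near (k + l) (glue i f f') ∧ Near (k + l) (glue i f' f) := by
  have e₁ : glue i q (q + a) = (fun x => q (i.removeNth x)) +
      (fun x => x i) * fun x => a (i.removeNth x) := by
    funext x
    simp only [glue, Pi.add_apply, Pi.mul_apply]
    linear_combination (x i * q (i.removeNth x)) * (CharTwo.two_eq_zero : (2 : ZMod 2) = 0)
  have e₂ : glue i (q + a) q = (fun x => (q + a) (i.removeNth x)) +
      (fun x => x i) * fun x => a (i.removeNth x) := by
    funext x
    simp only [glue, Pi.add_apply, Pi.mul_apply]
    linear_combination (x i * q (i.removeNth x)) * (CharTwo.two_eq_zero : (2 : ZMod 2) = 0)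
  have hprod := RM_mul (RM_coord i) (RM_removeNth i ha)
  constructor
  · refine ⟨glue i q (q + a), e₁ ▸ RM_add (RM_removeNth i hq) hprod, ?_⟩
    rw [hd_eq_add_face i, face_zero_glue, face_one_glue, face_zero_glue, face_one_glue]
    exact add_le_add h h'
  · refine ⟨glue i (q + a) q, e₂ ▸ RM_add (RM_removeNth i
      (RM_add hq (RM_mono (by norm_num) ha))) hprod, ?_⟩
    rw [hd_eq_add_face i, face_zero_glue, face_one_glue, face_zero_glue, face_one_glue, add_comm]
    exact add_le_add h h'

theorem near_glue {n k l : ℕ} (i : Fin (n + 1)) {f f' : BF n} (h : Near k f) (h' : Covered l f') :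
    Near (k + l) (glue i f f') ∧ Near (k + l) (glue i f' f) := by
  obtain ⟨q, hq, hle⟩ := h
  obtain ⟨a, ha, hle'⟩ := h' q hq
  refine exists_near_glue i f f' hq ha hle ?_
  rwa [add_comm, ← hd_add_swap]

theorem glue_face {n : ℕ} (i : Fin (n + 1)) (F : BF (n + 1)) :
    glue i (face i 0 F) (face i 1 F) = F := by
  have key : ∀ F G : BF (n + 1), face i 0 F = face i 0 G → face i 1 F = face i 1 G → F = G := by
    intro F G h0 h1
    funext x
    rw [← i.insertNth_self_removeNth x]
    have : ∀ c : ZMod 2, c = 0 ∨ c = 1 := by decide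
    rcases this (x i) with h | h <;> rw [h]
    · exact congrFun h0 _
    · exact congrFun h1 _
  exact key _ _ (face_zero_glue i _ _) (face_one_glue i _ _)

theorem Near.mono {n k l : ℕ} (h : k ≤ l) {f : BF n} (hf : Near k f) : Near l f :=
  hf.imp fun _ ha => ⟨ha.1, ha.2.trans h⟩

theorem exists_twoCubics_face {F : BF 6} (hF : ¬ Near 16 F) (i : Fin 6) :
    ∃ c, TwoCubics (face i c F) := by
  have aux : ∀ {f f' : BF 5} {k l : ℕ}, (glue i f f' = F ∨ glue i f' f = F) → Near k f →
      Covered l f' → k + l ≤ 16 → False := by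
    intro f f' k l he h h' hkl
    obtain ⟨h₁, h₂⟩ := near_glue i h h'
    rcases he with rfl | rfl
    · exact hF (h₁.mono hkl)
    · exact hF (h₂.mono hkl)
  have he := glue_face i F
  obtain ⟨c₀, k₀⟩ := kind5 (face i 0 F)
  obtain ⟨c₁, k₁⟩ := kind5 (face i 1 F)
  rcases k₀ with n₀ | ⟨n₀, d₀⟩ | ⟨n₀, d₀⟩ | ⟨n₀, t₀⟩
  · exact (aux (.inl he) n₀ c₁ (by norm_num)).elim
  · rcases k₁ with n₁ | ⟨n₁, d₁⟩ | ⟨n₁, d₁⟩ | ⟨n₁, t₁⟩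
    · exact (aux (.inr he) n₁ c₀ (by norm_num)).elim
    · exact (aux (.inr he) n₁ d₀ (by norm_num)).elim
    · exact (aux (.inr he) n₁ d₀ (by norm_num)).elim
    · exact ⟨1, t₁⟩
  · rcases k₁ with n₁ | ⟨n₁, d₁⟩ | ⟨n₁, d₁⟩ | ⟨n₁, t₁⟩
    · exact (aux (.inr he) n₁ c₀ (by norm_num)).elim
    · exact (aux (.inl he) n₀ d₁ (by norm_num)).elim
    · exact (aux (.inl he) n₀ d₁ (by norm_num)).elim
    · exact ⟨1, t₁⟩
  · exact ⟨0, t₀⟩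

theorem isAff_addRight {n : ℕ} (ε : Fin n → ZMod 2) : IsAff (Equiv.addRight ε) :=
  ⟨fun i => RM_add (RM_coord i) (RM_const (ε i)), fun i => RM_add (RM_coord i) (RM_const (-ε i))⟩

theorem exists_addRight_twoCubics {F : BF 6} (hF : ¬ Near 16 F) :
    ∃ σ, IsAff σ ∧ ∀ i, TwoCubics (face i 0 (F ∘ σ)) := by
  choose ε hε using exists_twoCubics_face hF
  refine ⟨Equiv.addRight ε, isAff_addRight ε, fun i => ?_⟩
  have e : face i 0 (F ∘ Equiv.addRight ε) = face i (ε i) F ∘ Equiv.addRight (i.removeNth ε) := by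
    funext y
    change F (i.insertNth 0 y + ε) = F (i.insertNth (ε i) (y + i.removeNth ε))
    congr 1
    funext j
    induction j using i.succAboveCases with
    | x => simp
    | p j => simp [Fin.removeNth]
  rw [e]
  exact inv_twoCubics.comp _ _ (isAff_addRight _) (hε i)

theorem TwoCubics.mem_RM {f : BF 5} (h : TwoCubics f) : f ∈ RM 3 5 := by
  obtain ⟨σ, hσ, h⟩ := h
  have h3 : an 5 532480 ∈ RM 3 5 := an_mem_RM (by norm_num) (by decide +kernel)
  have := RM_add (RM_mono (by norm_num) h) h3
  rw [BF_add_cancel] at this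
  have := RM_comp_aff this hσ.symm
  rwa [Function.comp_assoc, Equiv.self_comp_symm, Function.comp_id] at this

theorem an_and_lowMask {n : ℕ} (hn : n + 1 ≤ 6) (A : ℕ) (i : Fin (n + 1)) :
    an (n + 1) (A &&& lowMask i) = fun x => face i 0 (an (n + 1) A) (i.removeNth x) := by
  funext x
  simp only [an, face]
  refine Finset.sum_congr rfl fun m hm => ?_
  rw [Nat.testBit_and, lowMask_testBit i (by omega) m (by simpa using hm)]
  by_cases hlt : m < 2 ^ (n + 1)
  · rw [monomial_eq hlt, monomial_eq hlt]
    cases hb : m.testBit i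
    · rw [Bool.not_false, Bool.and_true]
      congr 1
      refine Finset.prod_congr rfl fun l _ => ?_
      by_cases hl : l = i
      · rw [hl, hb]
        rfl
      · obtain ⟨l, rfl⟩ := Fin.exists_succAbove_eq hl
        simp [Fin.removeNth]
    · have : (∏ l : Fin (n + 1), if m.testBit l = true then
          (i.insertNth 0 (i.removeNth x) : Fin (n + 1) → ZMod 2) l else 1) = 0 :=
        Finset.prod_eq_zero (Finset.mem_univ i) (by simp [hb])
      rw [this]
      simp [bit]
  · have : ∀ x : Fin (n + 1) → ZMod 2, (m &&& idx x == m) = false := fun x => by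
      have h1 := Nat.and_le_right (n := m) (m := idx x)
      have h2 := idx_lt x
      rw [beq_eq_false_iff_ne]
      omega
    rw [this, this]
    simp [bit]

theorem an_and_lowMask_mem_RM {r n : ℕ} (hn : n + 1 ≤ 6) (A : ℕ) (i : Fin (n + 1))
    (h : face i 0 (an (n + 1) A) ∈ RM r n) : an (n + 1) (A &&& lowMask i) ∈ RM r (n + 1) := by
  rw [an_and_lowMask hn]
  exact RM_removeNth i h

theorem bw_le_of_an_mem_RM {A r m : ℕ} (hA : A < 2 ^ 64) (h : an 6 A ∈ RM r 6)
    (hm : A.testBit m = true) : bw m ≤ r := by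
  obtain ⟨B, hB, hbits, e⟩ := exists_an_of_RM le_rfl h
  obtain rfl := an_injective hB hA e
  exact (hbits m hm).2

theorem face_last_an (n A : ℕ) : face (Fin.last n) 0 (an (n + 1) A) = an n A := by
  funext y
  have hv : (Fin.last n).insertNth 0 y = vec (n + 1) (idx y) := by
    funext i
    induction i using Fin.lastCases with
    | last => simp [vec, bit, Nat.testBit_lt_two_pow (idx_lt y)]
    | cast i => simpa [vec] using (bit_testBit_idx y i).symm
  have : idx ((Fin.last n).insertNth 0 y : Fin (n + 1) → ZMod 2) = idx y := by
    rw [hv, idx_vec ((idx_lt y).trans (Nat.pow_lt_pow_right (by norm_num) n.lt_succ_self))]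
  rw [face, an, this, an]

/-- The extension of a bijection by the identity on the last coordinate. -/
def extendLast {n : ℕ} (σ : (Fin n → ZMod 2) ≃ (Fin n → ZMod 2)) :
    (Fin (n + 1) → ZMod 2) ≃ (Fin (n + 1) → ZMod 2) where
  toFun x := (Fin.last n).insertNth (x (Fin.last n)) (σ ((Fin.last n).removeNth x))
  invFun x := (Fin.last n).insertNth (x (Fin.last n)) (σ.symm ((Fin.last n).removeNth x))
  left_inv x := by simp
  right_inv x := by simp

theorem isAff_extendLast {n : ℕ} {σ : (Fin n → ZMod 2) ≃ (Fin n → ZMod 2)} (h : IsAff σ) :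
    IsAff (extendLast σ) := by
  constructor <;> intro i <;> cases i using (Fin.last n).succAboveCases with
  | x => simpa [extendLast] using RM_coord (Fin.last n)
  | p j =>
    first
    | simpa [extendLast, Fin.insertNth_apply_succAbove] using RM_removeNth (Fin.last n) (h.1 j)
    | simpa [extendLast, Fin.insertNth_apply_succAbove] using RM_removeNth (Fin.last n) (h.2 j)

theorem face_extendLast {n : ℕ} (σ : (Fin n → ZMod 2) ≃ (Fin n → ZMod 2)) (F : BF (n + 1)) :
    face (Fin.last n) 0 (F ∘ extendLast σ) = face (Fin.last n) 0 F ∘ σ := by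
  funext y
  simp [face, extendLast]

theorem dichPt_of_twoCubics_face {G : BF 6} (hG : G ∈ RM 3 6)
    (h : TwoCubics (face (Fin.last 5) 0 G)) : DichPt G := by
  obtain ⟨σ, hσ, hq⟩ := h
  refine inv_dichPt.of_comp (isAff_extendLast hσ) ?_
  rw [← face_extendLast] at hq
  obtain ⟨B, hB, hbits, e⟩ := exists_an_of_RM le_rfl (RM_comp_aff hG (isAff_extendLast hσ))
  rw [← e] at hq ⊢
  have hL : an 6 ((B ^^^ 532480) &&& lowMask 5) ∈ RM 2 6 := by
    refine an_and_lowMask_mem_RM le_rfl _ (Fin.last 5) ?_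
    rw [an_xor]
    rw [← face_last_an] at hq
    exact hq
  refine inv_dichPt.of_land le_rfl drops6_two B ?_
  have hS : 532480 ^^^ (532480 ^^^ (B &&& 18446461400418674816)) = B &&& 18446461400418674816 := by
    rw [← Nat.xor_assoc, Nat.xor_self, Nat.zero_xor]
  have hlt : B &&& 18446461400418674816 < 2 ^ 64 := Nat.and_le_left.trans_lt hB
  rw [← hS]
  refine dichPt_extension ?_ (by rwa [hS]) (by rw [hS, Nat.and_assoc, Nat.and_self])
  intro m hm
  have h64 : (532480 ^^^ (B &&& 18446461400418674816)) < 2 ^ 64 :=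
    Nat.xor_lt_two_pow (by norm_num) hlt
  have hm64 : m < 64 := by
    by_contra hc
    rw [Nat.testBit_lt_two_pow (h64.trans_le (Nat.pow_le_pow_right (by norm_num)
      (not_lt.1 hc)))] at hm
    exact Bool.false_ne_true hm
  have h3 : B.testBit m = true → bw m ≤ 3 := fun hb => (hbits m hb).2
  have h2 : ((B ^^^ 532480) &&& lowMask 5).testBit m = true → bw m ≤ 2 :=
    bw_le_of_an_mem_RM (Nat.and_le_left.trans_lt (Nat.xor_lt_two_pow hB (by norm_num))) hL
  rw [Nat.testBit_and, Nat.testBit_xor, lowMask_testBit 5 (by norm_num) m hm64] at h2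
  rw [Nat.testBit_xor, Nat.testBit_and] at hm
  have key : ∀ m < 64, ∀ b : Bool, ((b = true → bw m ≤ 3) ∧
      (((b ^^ Nat.testBit 532480 m) && !m.testBit 5) = true → bw m ≤ 2) ∧
      (Nat.testBit 532480 m ^^ (b && Nat.testBit 18446461400418674816 m)) = true) →
      List.elem m cubicExt = true := by
    decide +kernel
  exact List.elem_iff.1 (key m hm64 _ ⟨h3, h2, hm⟩)

theorem an_two_pow_last : an 6 (2 ^ 63) = pt 1 := by
  funext x
  have h : ∀ k < 64, (63 &&& k == 63) = decide (k = 63) := by decide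
  have h1 : idx (1 : Fin 6 → ZMod 2) = 63 := by decide
  rw [an_two_pow (by norm_num), h _ (idx_lt x), ← h1, pt, bit]
  simp only [decide_eq_true_eq, idx_injective.eq_iff]

theorem dich (F : BF 6) : Dich F := by
  by_cases hF : Near 16 F
  · exact .inl hF
  obtain ⟨σ, hσ, hT⟩ := exists_addRight_twoCubics hF
  refine inv_dich.of_comp hσ ?_
  obtain ⟨A, hA, e⟩ := exists_an le_rfl (F ∘ σ)
  rw [← e] at hT ⊢
  have hbits : ∀ m < 63, A.testBit m = true → bw m ≤ 3 := by
    intro m hm hb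
    obtain ⟨i, hi⟩ : ∃ i : Fin 6, m.testBit i = false := by
      clear hb
      revert m
      decide
    refine bw_le_of_an_mem_RM (Nat.and_le_left.trans_lt hA)
      (an_and_lowMask_mem_RM le_rfl A i (hT i).mem_RM) ?_
    rw [Nat.testBit_and, lowMask_testBit i i.2 m (by omega), hb, hi]
    rfl
  have hG : an 6 (A &&& (2 ^ 63 - 1)) ∈ RM 3 6 := an_mem_RM le_rfl fun m _ hb _ => by
    rw [Nat.testBit_and, Nat.testBit_two_pow_sub_one, Bool.and_eq_true, decide_eq_true_eq] at hb
    exact hbits m hb.2 hb.1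
  have hs : A = (A &&& (2 ^ 63 - 1)) ^^^ (A &&& 2 ^ 63) := by
    rw [← Nat.and_xor_distrib_left, show (2 ^ 63 - 1) ^^^ 2 ^ 63 = 2 ^ 64 - 1 by decide,
      Nat.and_two_pow_sub_one_eq_mod, Nat.mod_eq_of_lt hA]
  have hd : an 6 A = an 6 (A &&& (2 ^ 63 - 1)) ∨ an 6 A = an 6 (A &&& (2 ^ 63 - 1)) + pt 1 := by
    rw [← an_two_pow_last, ← an_xor]
    rw [Nat.and_two_pow] at hs
    cases hb : A.testBit 63 <;> rw [hb] at hs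
    · exact .inl (congrArg _ (by simpa using hs))
    · exact .inr (congrArg _ (by simpa using hs))
  have hp : face (Fin.last 5) 0 (pt 1) = 0 := by
    funext y
    rw [face, pt, if_neg]
    · rfl
    · intro h
      have := congrFun h (Fin.last 5)
      simp at this
  have hface : face (Fin.last 5) 0 (an 6 A) = face (Fin.last 5) 0 (an 6 (A &&& (2 ^ 63 - 1))) := by
    rcases hd with h | h <;> rw [h]
    funext y
    have := congrFun hp y
    change _ + face (Fin.last 5) 0 (pt 1) y = _
    rw [this]
    exact add_zero _
  have hP := dichPt_of_twoCubics_face hG (hface ▸ hT (Fin.last 5))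
  rcases hd with h | h <;> rw [h]
  · exact hP.1
  · exact hP.2 1

theorem exists_hd_eq_nl {n : ℕ} (r : ℕ) (f : BF n) : ∃ g ∈ RM r n, hd f g = nl r f := by
  obtain ⟨g, hg, h⟩ := Nat.sInf_mem (s := {d | ∃ g ∈ RM r n, d = hd f g})
    ⟨hd f 0, 0, RM_zero, rfl⟩
  exact ⟨g, hg, h.symm⟩

theorem Near.nl_le {n k : ℕ} {f : BF n} (h : Near k f) : nl 2 f ≤ k := by
  obtain ⟨Q, hQ, hle⟩ := h
  have : nl 2 f ≤ hd f Q := Nat.sInf_le ⟨Q, hQ, rfl⟩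
  exact this.trans hle

theorem concat_eq_glue {n : ℕ} (f g : BF n) : concat f g = glue (Fin.last n) f g := by
  funext x
  rw [concat, glue, Fin.removeNth_last]
  rfl
/-- If `nl_2(f1) = 17` then `nl_2(f1||f2) ≤ 40`. -/
theorem stmt17 (f1 f2 : BF 6) (h1 : nl 2 f1 = 17) :
    nl 2 (concat f1 f2) ≤ 40 := by
  have hn : ¬ Near 16 f1 := fun h => by
    have := h.nl_le
    omega
  have hc : Covered 23 f1 := (dich f1).resolve_left hn
  have hf : Near 17 f1 := by
    obtain ⟨Q, hQ, h⟩ := exists_hd_eq_nl 2 f1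
    exact ⟨Q, hQ, (h.trans h1).le⟩
  rw [concat_eq_glue]
  rcases dich f2 with h | h
  · exact (near_glue (Fin.last 6) h hc).2.nl_le.trans (by norm_num)
  · exact (near_glue (Fin.last 6) hf h).1.nl_le
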